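/- arXiv:2511.06543 — 3 statements merged into one kernel-verified Lean document; each statement's English description precedes it below -/
import Mathlib

section
/- Let K be a compact subset of the unit circle of arclength measure 0 and L a compact subset of the open unit disc. Let φ : K → ℂ be continuous with sup_K |φ| ≤ 1, let f be holomorphic on the open unit disc with |f| ≤ 1, and let ε > 0. Then there exists r₀ ∈ (0,1) such that for every r ∈ (r₀,1) there exists a finite Blaschke product B with sup_{z∈K} |B(rz) − φ(z)| < ε and sup_{z∈L} |B(z) − f(z)| < ε. -/
open Complex Metric MeasureTheory Filter Set

noncomputable section

/-- A finite Blaschke product: a unimodular constant times a finite product of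
disc automorphisms `z ↦ (z - wₖ)/(1 - conj wₖ · z)` with `wₖ` in the open unit disc. -/
def IsFiniteBlaschke (B : ℂ → ℂ) : Prop :=
  ∃ (n : ℕ) (ζ : ℂ) (w : Fin (n + 1) → ℂ),
    ‖ζ‖ = 1 ∧ (∀ k, ‖w k‖ < 1) ∧
    ∀ z : ℂ, B z = ζ * ∏ k, (z - w k) / (1 - (starRingEnd ℂ) (w k) * z)

/-- Arclength measure on the unit circle, viewed as a measure on `ℂ`. -/
def arclength : Measure ℂ :=
  Measure.map (circleMap 0 1) (volume.restrict (Set.Ioc 0 (2 * Real.pi)))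

/-- The building block `η + ∑ ρₓ / (1 + ρₓ - conj x · z)`, with positive real part on the disc. -/
def cellSum (t : Finset ℂ) (ρ : ℂ → ℝ) (η : ℝ) (z : ℂ) : ℂ :=
  η + ∑ x ∈ t, (ρ x : ℂ) / (1 + ρ x - (starRingEnd ℂ) x * z)

lemma ofReal_le_arclength_closedBall {x : ℂ} (hx : ‖x‖ = 1) {r : ℝ} (hr0 : 0 < r) (hr1 : r < 1) :
    ENNReal.ofReal r ≤ arclength (closedBall x r) := by
  have hπ := Real.pi_gt_three
  obtain ⟨θ, hθ, rfl⟩ : ∃ θ ∈ Ioc 0 (2 * Real.pi), circleMap 0 1 θ = x := by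
    have : x ∈ circleMap 0 1 '' Ioc 0 (2 * Real.pi) := by
      rw [image_circleMap_Ioc]; simp [hx]
    exact this
  rw [arclength, Measure.map_apply (continuous_circleMap 0 1).measurable
    measurableSet_closedBall, Measure.restrict_apply
    ((continuous_circleMap 0 1).measurable measurableSet_closedBall)]
  have key : ∀ s : ℝ, |s - θ| ≤ r → circleMap 0 1 s ∈ closedBall (circleMap 0 1 θ) r := by
    intro s hs
    have := (lipschitzWith_circleMap 0 1).dist_le_mul s θ
    simp only [mem_closedBall]
    refine this.trans ?_
    simpa [Real.dist_eq] using hs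
  by_cases h : r ≤ θ
  · rw [show ENNReal.ofReal r = volume (Ioc (θ - r) θ) by simp]
    exact measure_mono fun s hs => ⟨key s (by rw [abs_le]; constructor <;> linarith [hs.1, hs.2]),
      by linarith [hs.1], hs.2.trans hθ.2⟩
  · rw [show ENNReal.ofReal r = volume (Ioc θ (θ + r)) by simp]
    exact measure_mono fun s hs => ⟨key s (by rw [abs_le]; constructor <;> linarith [hs.1, hs.2]),
      hθ.1.trans hs.1, by linarith [hs.2]⟩

instance : IsFiniteMeasure arclength := by
  unfold arclength; infer_instance

lemma exists_finite_cover_of_arclength_eq_zero {K : Set ℂ} (hKc : IsCompact K)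
    (hKs : K ⊆ sphere (0 : ℂ) 1) (hK0 : arclength K = 0) {η : ℝ} (hη : 0 < η) :
    ∃ (t : Finset ℂ) (ρ : ℂ → ℝ), (∀ x ∈ t, x ∈ K) ∧ (∀ x ∈ t, 0 < ρ x) ∧
      ∑ x ∈ t, ρ x ≤ η ∧ K ⊆ ⋃ x ∈ t, ball x (ρ x) := by
  obtain ⟨t, r, -, htK, hr, hcov, hsum⟩ :=
    Besicovitch.exists_closedBall_covering_tsum_measure_le arclength
      (ε := ENNReal.ofReal (η / 2)) (by simpa using hη) (fun _ => Ioo 0 1) K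
      (fun x _ δ hδ => by simpa [Ioo_inter_Ioo] using hδ)
  obtain ⟨s, hst, hsf, hs⟩ := hKc.elim_finite_subcover_image (b := t)
    (c := fun x => ball x (2 * r x)) (fun _ _ => isOpen_ball)
    (hcov.trans <| iUnion₂_mono fun x hx => closedBall_subset_ball (by linarith [(hr x hx).1]))
  lift s to Finset ℂ using hsf
  have hx1 : ∀ x ∈ s, ‖x‖ = 1 := fun x hx => by simpa using hKs (htK (hst hx))
  refine ⟨s, fun x => 2 * r x, fun x hx => htK (hst hx), fun x hx => by linarith [(hr x (hst hx)).1], ?_, by simpa using hs⟩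
  have h1 : ∑ x ∈ s, ENNReal.ofReal (r x) ≤ ENNReal.ofReal (η / 2) := calc
    _ ≤ ∑ x ∈ s, arclength (closedBall x (r x)) := Finset.sum_le_sum fun x hx =>
        ofReal_le_arclength_closedBall (hx1 x hx) (hr x (hst hx)).1 (hr x (hst hx)).2
    _ = ∑' x : (s : Set ℂ), arclength (closedBall (x : ℂ) (r x)) :=
        (Finset.tsum_subtype s fun x => arclength (closedBall x (r x))).symm
    _ ≤ ∑' x : t, arclength (closedBall (x : ℂ) (r x)) :=
        ENNReal.tsum_mono_subtype (fun x => arclength (closedBall x (r x))) hst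
    _ ≤ _ := by simpa [hK0] using hsum
  rw [← ENNReal.ofReal_sum_of_nonneg fun x hx => (hr x (hst hx)).1.le,
    ENNReal.ofReal_le_ofReal_iff (by positivity)] at h1
  rw [← Finset.mul_sum]; linarith

lemma exists_cos_sector {c : ℝ} (h0 : 0 < c) (h1 : c < 1) : ∃ α : ℝ, 0 < α ∧
    ∀ w : ℂ, 0 < w.re → c * ‖w ^ (α : ℂ)‖ ≤ (w ^ (α : ℂ)).re := by
  refine ⟨Real.arccos c / (Real.pi / 2), by have := Real.arccos_pos.2 h1; positivity, fun w hw => ?_⟩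
  set α := Real.arccos c / (Real.pi / 2) with hα
  have hw0 : w ≠ 0 := by rintro rfl; simp at hw
  have hα0 : 0 < α := by have := Real.arccos_pos.2 h1; positivity
  have harg : |w.arg| < Real.pi / 2 := abs_arg_lt_pi_div_two_iff.2 (Or.inl hw)
  have hcos : c ≤ Real.cos (α * w.arg) := by
    rw [← Real.cos_abs, abs_mul, abs_of_pos hα0]
    calc c = Real.cos (Real.arccos c) := (Real.cos_arccos (by linarith) h1.le).symm
      _ ≤ _ := by
        apply Real.cos_le_cos_of_nonneg_of_le_pi (by positivity) (Real.arccos_le_pi c)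
        calc α * |w.arg| ≤ α * (Real.pi / 2) := by gcongr
          _ = _ := by rw [hα]; field_simp
  rw [cpow_def_of_ne_zero hw0, norm_exp, exp_re]
  have : (log w * α).im = α * w.arg := by rw [mul_comm, im_ofReal_mul, log_im]
  rw [this, mul_comm]
  gcongr

lemma re_conj_mul_le {x z : ℂ} (hx : ‖x‖ = 1) (hz : ‖z‖ < 1) :
    ((starRingEnd ℂ) x * z).re < 1 :=
  (re_le_norm _).trans_lt (by simpa [hx] using hz)

lemma norm_one_sub_conj_mul {x z : ℂ} (hx : ‖x‖ = 1) :
    ‖1 - (starRingEnd ℂ) x * z‖ = ‖z - x‖ := by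
  have : 1 - (starRingEnd ℂ) x * z = (starRingEnd ℂ) x * (x - z) := by
    rw [mul_sub, mul_comm _ x, mul_conj, normSq_eq_norm_sq, hx]; simp
  rw [this, norm_mul, norm_conj, hx, one_mul, norm_sub_rev]

lemma re_cellSum_summand_pos {x z : ℂ} {r : ℝ} (hx : ‖x‖ = 1) (hr : 0 < r) (hz : ‖z‖ < 1) :
    0 < ((r : ℂ) / (1 + r - (starRingEnd ℂ) x * z)).re := by
  have h1 := re_conj_mul_le hx hz
  have h2 : 0 < (1 + r - (starRingEnd ℂ) x * z).re := by
    simp only [sub_re, add_re, one_re, ofReal_re]; linarith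
  rw [div_eq_mul_inv, re_ofReal_mul, inv_re]
  have : 0 < normSq (1 + r - (starRingEnd ℂ) x * z) := normSq_pos.2 fun h => by simp [h] at h2
  positivity

lemma re_cellSum_summand_ge {x z : ℂ} {r : ℝ} (hx : ‖x‖ = 1) (hr : 0 < r) (hz : ‖z‖ < 1)
    (hxz : ‖z - x‖ < r) : 1 / 4 ≤ ((r : ℂ) / (1 + r - (starRingEnd ℂ) x * z)).re := by
  have h1 := re_conj_mul_le hx hz
  have h2 : r ≤ (1 + r - (starRingEnd ℂ) x * z).re := by
    simp only [sub_re, add_re, one_re, ofReal_re]; linarith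
  have h3 : ‖1 + r - (starRingEnd ℂ) x * z‖ ≤ 2 * r := calc
    _ = ‖(1 - (starRingEnd ℂ) x * z) + r‖ := by congr 1; ring
    _ ≤ ‖1 - (starRingEnd ℂ) x * z‖ + ‖(r : ℂ)‖ := norm_add_le _ _
    _ ≤ 2 * r := by
      rw [norm_one_sub_conj_mul hx, norm_real, Real.norm_of_nonneg hr.le]; linarith
  have h4 : 0 < normSq (1 + r - (starRingEnd ℂ) x * z) :=
    normSq_pos.2 fun h => by simp [h] at h2; linarith
  rw [div_eq_mul_inv (r : ℂ), re_ofReal_mul, inv_re, ← mul_div_assoc, div_le_div_iff₀ (by norm_num) h4,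
    normSq_eq_norm_sq]
  have := norm_nonneg (1 + r - (starRingEnd ℂ) x * z)
  nlinarith

lemma norm_cellSum_summand_le {x z : ℂ} {r c : ℝ} (hx : ‖x‖ = 1) (hr : 0 < r) (hz : ‖z‖ < 1)
    (hc : 0 < c) (hxz : c ≤ ‖z - x‖) : ‖(r : ℂ) / (1 + r - (starRingEnd ℂ) x * z)‖ ≤ r / c := by
  have h1 := re_conj_mul_le hx hz
  rw [norm_div, norm_real, Real.norm_of_nonneg hr.le]
  gcongr
  rw [← norm_one_sub_conj_mul hx] at hxz
  refine hxz.trans ?_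
  rw [← sq_le_sq₀ (norm_nonneg _) (norm_nonneg _), ← normSq_eq_norm_sq, ← normSq_eq_norm_sq,
    normSq_apply, normSq_apply]
  simp only [sub_re, add_re, one_re, ofReal_re, sub_im, add_im, one_im, ofReal_im]
  nlinarith

section cellSum

variable {t : Finset ℂ} {ρ : ℂ → ℝ} {η : ℝ} {z : ℂ}

lemma re_cellSum_pos (hη : 0 < η) (ht : ∀ x ∈ t, ‖x‖ = 1) (hρ : ∀ x ∈ t, 0 < ρ x)
    (hz : ‖z‖ < 1) : 0 < (cellSum t ρ η z).re := by
  have := Finset.sum_nonneg fun x hx => (re_cellSum_summand_pos (ht x hx) (hρ x hx) hz).le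
  simp only [cellSum, add_re, re_sum, ofReal_re]
  linarith

lemma re_cellSum_ge (hη : 0 < η) (ht : ∀ x ∈ t, ‖x‖ = 1) (hρ : ∀ x ∈ t, 0 < ρ x)
    (hz : ‖z‖ < 1) {x : ℂ} (hx : x ∈ t) (hxz : ‖z - x‖ < ρ x) :
    1 / 4 ≤ (cellSum t ρ η z).re := by
  have h1 := Finset.single_le_sum
    (fun x hx => (re_cellSum_summand_pos (ht x hx) (hρ x hx) hz).le) hx
  have h2 := re_cellSum_summand_ge (ht x hx) (hρ x hx) hz hxz
  simp only [cellSum, add_re, re_sum, ofReal_re]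
  linarith

lemma norm_cellSum_le {c : ℝ} (hη : 0 < η) (hc : 0 < c)
    (ht : ∀ x ∈ t, ‖x‖ = 1) (hρ : ∀ x ∈ t, 0 < ρ x) (hs : ∑ x ∈ t, ρ x ≤ η)
    (hz : ‖z‖ < 1) (hzt : ∀ x ∈ t, c ≤ ‖z - x‖) : ‖cellSum t ρ η z‖ ≤ η * (1 + 1 / c) := by
  calc ‖cellSum t ρ η z‖
      ≤ ‖(η : ℂ)‖ + ∑ x ∈ t, ‖(ρ x : ℂ) / (1 + ρ x - (starRingEnd ℂ) x * z)‖ :=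
        (norm_add_le _ _).trans (by gcongr; exact norm_sum_le _ _)
    _ ≤ η + ∑ x ∈ t, ρ x / c := by
        gcongr with x hx
        · rw [norm_real, Real.norm_of_nonneg hη.le]
        · exact norm_cellSum_summand_le (ht x hx) (hρ x hx) hz hc (hzt x hx)
    _ ≤ η * (1 + 1 / c) := by
        rw [← Finset.sum_div, mul_add, mul_one, mul_one_div]; gcongr

lemma differentiableOn_cellSum (ht : ∀ x ∈ t, ‖x‖ = 1) (hρ : ∀ x ∈ t, 0 < ρ x) :
    DifferentiableOn ℂ (cellSum t ρ η) (ball 0 1) := by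
  intro z hz
  rw [mem_ball_zero_iff] at hz
  refine ((differentiableAt_const _).add (DifferentiableAt.fun_sum fun x hx => ?_)).differentiableWithinAt
  refine (differentiableAt_const _).div (by fun_prop) fun h => ?_
  simpa [h] using re_cellSum_summand_pos (ht x hx) (hρ x hx) hz

end cellSum

lemma exists_sector_cells {K : Set ℂ} (hKc : IsCompact K)
    (hKs : K ⊆ sphere (0 : ℂ) 1) (hK0 : arclength K = 0) {P : Finset ℂ} {d : ℝ}
    (hP : K ⊆ ⋃ p ∈ P, ball p d) {c₀ : ℝ} (h0 : 0 < c₀) (h1 : c₀ < 1) {A κ c : ℝ} (hA : 0 < A)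
    (hκ : 0 < κ) (hc : 0 < c) :
    ∃ (S : ℂ → ℂ → ℂ) (U : Set ℂ), IsOpen U ∧ K ⊆ U ∧
      (∀ p, DifferentiableOn ℂ (S p) (ball 0 1)) ∧
      (∀ p, ∀ z ∈ ball (0 : ℂ) 1, c₀ * ‖S p z‖ ≤ (S p z).re) ∧
      (∀ z ∈ U, z ∈ ball (0 : ℂ) 1 → ∃ p ∈ P, A ≤ ‖S p z‖) ∧
      (∀ p, ∀ z ∈ ball (0 : ℂ) 1, d + c ≤ ‖z - p‖ ∨ ‖z‖ ≤ 1 - c → ‖S p z‖ ≤ κ) := by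
  obtain ⟨α, hα, hsec⟩ := exists_cos_sector h0 h1
  set M : ℝ := 4 * A ^ α⁻¹ with hM
  have hM0 : 0 < M := by positivity
  set η : ℝ := κ ^ α⁻¹ / (M * (1 + 1 / c)) with hη
  have hη0 : 0 < η := by positivity
  obtain ⟨t, ρ, htK, hρ, hsum, hcov⟩ := exists_finite_cover_of_arclength_eq_zero hKc hKs hK0 hη0
  let T : ℂ → Finset ℂ := fun p => t.filter fun x => ‖x - p‖ < d
  have hTt : ∀ p, T p ⊆ t := fun p => Finset.filter_subset _ _
  have ht1 : ∀ p, ∀ x ∈ T p, ‖x‖ = 1 := fun p x hx => by simpa using hKs (htK x (hTt p hx))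
  have hTρ : ∀ p, ∀ x ∈ T p, 0 < ρ x := fun p x hx => hρ x (hTt p hx)
  have hre : ∀ p, ∀ z ∈ ball (0 : ℂ) 1, 0 < (M * cellSum (T p) ρ η z).re := fun p z hz => by
    rw [re_ofReal_mul]
    exact mul_pos hM0 (re_cellSum_pos hη0 (ht1 p) (hTρ p) (by simpa using hz))
  refine ⟨fun p z => (M * cellSum (T p) ρ η z) ^ (α : ℂ), ⋃ x ∈ t, ball x (ρ x),
    isOpen_biUnion fun _ _ => isOpen_ball, hcov, fun p => ?_, fun p z hz => hsec _ (hre p z hz),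
    fun z hz hz1 => ?_, fun p z hz hfar => ?_⟩
  · exact ((differentiableOn_cellSum (ht1 p) (hTρ p)).const_mul _).cpow_const
      fun z hz => Or.inl (hre p z hz)
  · simp only [mem_iUnion, mem_ball, dist_eq_norm, exists_prop] at hz
    obtain ⟨x, hx, hxz⟩ := hz
    have := hP (htK x hx)
    simp only [mem_iUnion, mem_ball, dist_eq_norm, exists_prop] at this
    obtain ⟨p, hp, hxp⟩ := this
    refine ⟨p, hp, ?_⟩
    have h := re_cellSum_ge hη0 (ht1 p) (hTρ p) (by simpa using hz1)
      (Finset.mem_filter.2 ⟨hx, hxp⟩) hxz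
    rw [norm_cpow_real, ← Real.rpow_inv_le_iff_of_pos hA.le (norm_nonneg _) hα]
    refine le_trans ?_ (re_le_norm _)
    rw [re_ofReal_mul]
    calc A ^ α⁻¹ = M * (1 / 4) := by rw [hM]; ring
      _ ≤ _ := by gcongr
  · rw [norm_cpow_real, ← Real.le_rpow_inv_iff_of_pos (norm_nonneg _) hκ.le hα, norm_mul, norm_real,
      Real.norm_of_nonneg hM0.le]
    have hsum' : ∑ x ∈ T p, ρ x ≤ η :=
      (Finset.sum_le_sum_of_subset_of_nonneg (hTt p) fun x hx _ => (hρ x hx).le).trans hsum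
    calc _ ≤ M * (η * (1 + 1 / c)) := by
          gcongr
          refine norm_cellSum_le hη0 hc (ht1 p) (hTρ p) hsum' (by simpa using hz) fun x hx => ?_
          rcases hfar with h | h
          · have h2 : ‖x - p‖ < d := (Finset.mem_filter.1 hx).2
            have := norm_sub_le_norm_sub_add_norm_sub z x p
            linarith
          · have := norm_sub_norm_le x z
            rw [ht1 p x hx, norm_sub_rev] at this
            linarith
      _ = κ ^ α⁻¹ := by rw [hη]; field_simp

section average

variable {P : Finset ℂ} {S a : ℂ → ℂ} {b τ : ℂ} {c₀ : ℝ}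

lemma le_norm_one_add_sum (h1 : c₀ ≤ 1) (hS : ∀ p ∈ P, c₀ * ‖S p‖ ≤ (S p).re) :
    c₀ * (1 + ∑ p ∈ P, ‖S p‖) ≤ ‖1 + ∑ p ∈ P, S p‖ := by
  refine le_trans ?_ (re_le_norm _)
  rw [add_re, one_re, re_sum, mul_add, mul_one, Finset.mul_sum]
  exact add_le_add h1 (Finset.sum_le_sum hS)

lemma norm_average_le_one (h0 : 0 < c₀) (h1 : c₀ ≤ 1) (hS : ∀ p ∈ P, c₀ * ‖S p‖ ≤ (S p).re)
    (hb : ‖b‖ ≤ 1) (ha : ∀ p ∈ P, ‖a p‖ ≤ 1) :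
    ‖c₀ * ((b + ∑ p ∈ P, a p * S p) / (1 + ∑ p ∈ P, S p))‖ ≤ 1 := by
  have hD := le_norm_one_add_sum h1 hS
  have hT : 0 < 1 + ∑ p ∈ P, ‖S p‖ := by positivity
  rw [norm_mul, norm_div, norm_real, Real.norm_of_nonneg h0.le, ← mul_div_assoc,
    div_le_one (lt_of_lt_of_le (by positivity) hD)]
  refine le_trans ?_ hD
  gcongr
  refine (norm_add_le _ _).trans (add_le_add hb ((norm_sum_le _ _).trans ?_))
  refine Finset.sum_le_sum fun p hp => ?_
  rw [norm_mul]
  exact mul_le_of_le_one_left (norm_nonneg _) (ha p hp)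

lemma norm_average_sub_le {e : ℝ} (h0 : 0 < c₀) (h1 : c₀ ≤ 1)
    (hS : ∀ p ∈ P, c₀ * ‖S p‖ ≤ (S p).re) (hτ : ‖τ‖ ≤ 1)
    (h : ‖b - τ‖ + ∑ p ∈ P, ‖a p - τ‖ * ‖S p‖ ≤ e * (1 + ∑ p ∈ P, ‖S p‖)) :
    ‖c₀ * ((b + ∑ p ∈ P, a p * S p) / (1 + ∑ p ∈ P, S p)) - τ‖ ≤ e + (1 - c₀) := by
  have hD := le_norm_one_add_sum h1 hS
  have hT : 0 < 1 + ∑ p ∈ P, ‖S p‖ := by positivity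
  have hD0 : 0 < ‖1 + ∑ p ∈ P, S p‖ := lt_of_lt_of_le (by positivity) hD
  have hne : 1 + ∑ p ∈ P, S p ≠ 0 := norm_pos_iff.1 hD0
  have heq : c₀ * ((b + ∑ p ∈ P, a p * S p) / (1 + ∑ p ∈ P, S p)) - τ =
      c₀ * (((b - τ) + ∑ p ∈ P, (a p - τ) * S p) / (1 + ∑ p ∈ P, S p)) - (1 - c₀ : ℝ) * τ := by
    simp only [sub_mul, Finset.sum_sub_distrib, ← Finset.mul_sum]
    push_cast
    field_simp
    ring
  rw [heq]
  refine (norm_sub_le _ _).trans (add_le_add ?_ ?_)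
  · rw [norm_mul, norm_div, norm_real, Real.norm_of_nonneg h0.le, ← mul_div_assoc, div_le_iff₀ hD0]
    have he : 0 ≤ e := by
      by_contra! he
      have : 0 ≤ ‖b - τ‖ + ∑ p ∈ P, ‖a p - τ‖ * ‖S p‖ := by positivity
      nlinarith
    calc _ ≤ c₀ * (‖b - τ‖ + ∑ p ∈ P, ‖a p - τ‖ * ‖S p‖) := by
          gcongr
          refine (norm_add_le _ _).trans (add_le_add le_rfl ((norm_sum_le _ _).trans ?_))
          simp
      _ ≤ c₀ * (e * (1 + ∑ p ∈ P, ‖S p‖)) := by gcongr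
      _ = e * (c₀ * (1 + ∑ p ∈ P, ‖S p‖)) := by ring
      _ ≤ _ := by gcongr
  · rw [norm_mul, norm_real, Real.norm_of_nonneg (by linarith)]
    exact mul_le_of_le_one_right (by linarith) hτ

end average

lemma exists_holomorphic_near {K : Set ℂ} (hKc : IsCompact K)
    (hKs : K ⊆ sphere (0 : ℂ) 1) (hK0 : arclength K = 0)
    {L : Set ℂ} (hLc : IsCompact L) (hLD : L ⊆ ball (0 : ℂ) 1)
    {φ : ℂ → ℂ} (hφc : ContinuousOn φ K) (hφ1 : ∀ z ∈ K, ‖φ z‖ ≤ 1)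
    {f : ℂ → ℂ} (hf : DifferentiableOn ℂ f (ball (0 : ℂ) 1))
    (hfb : ∀ z ∈ ball (0 : ℂ) 1, ‖f z‖ ≤ 1) {ε : ℝ} (hε : 0 < ε) :
    ∃ r₀ ∈ Ioo (0 : ℝ) 1, ∃ g : ℂ → ℂ, DifferentiableOn ℂ g (ball (0 : ℂ) 1) ∧
      (∀ z ∈ ball (0 : ℂ) 1, ‖g z‖ ≤ 1) ∧
      (∀ r ∈ Ioo r₀ 1, ∀ z ∈ K, ‖g ((r : ℂ) * z) - φ z‖ < ε) ∧ ∀ z ∈ L, ‖g z - f z‖ < ε := by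
  obtain ⟨ω, hω0, hω1, hωε⟩ : ∃ ω : ℝ, 0 < ω ∧ ω < 1 ∧ 4 * ω < ε :=
    ⟨min (ε / 8) (1 / 2), by positivity, by linarith [min_le_right (ε / 8) (1 / 2 : ℝ)],
      by linarith [min_le_left (ε / 8) (1 / 2 : ℝ)]⟩
  obtain ⟨δ, hδ, hφδ⟩ := Metric.uniformContinuousOn_iff.1
    (hKc.uniformContinuousOn_of_continuous hφc) ω hω0
  set d := δ / 4 with hd
  have hd0 : 0 < d := by positivity
  obtain ⟨P, hPK, hPf, hP⟩ := hKc.finite_cover_balls hd0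
  lift P to Finset ℂ using hPf
  obtain ⟨s, hs1, hLs⟩ := exists_lt_subset_ball hLc.isClosed hLD
  obtain ⟨c, hc0, hcd, hcs⟩ : ∃ c : ℝ, 0 < c ∧ c ≤ d ∧ c ≤ 1 - s :=
    ⟨min d (1 - s), lt_min hd0 (by linarith), min_le_left _ _, min_le_right _ _⟩
  set κ : ℝ := ω / (2 * (P.card + 1)) with hκ
  have hκ0 : 0 < κ := by positivity
  have hPκ : P.card * (2 * κ) ≤ ω := by
    rw [hκ, ← mul_div_assoc, ← mul_div_assoc, div_le_iff₀ (by positivity)]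
    nlinarith
  obtain ⟨S, U, hU, hKU, hSd, hSre, hSA, hSκ⟩ := exists_sector_cells hKc hKs hK0 (by simpa using hP)
    (c₀ := 1 - ω) (by linarith) (by linarith) (A := 2 / ω) (by positivity) hκ0 hc0
  obtain ⟨δ', hδ', hKδ'⟩ := hKc.exists_thickening_subset_open hU hKU
  have hterm : ∀ x y : ℂ, ‖x‖ ≤ 1 → ‖y‖ ≤ 1 → ‖x - y‖ ≤ 2 := fun x y hx hy =>
    (norm_sub_le _ _).trans (by linarith)
  refine ⟨max (1 / 2) (max (1 - d) (1 - δ')), ⟨by positivity, by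
      refine max_lt (by norm_num) (max_lt (by linarith) (by linarith))⟩,
    fun z => ((1 - ω : ℝ) : ℂ) * ((f z + ∑ p ∈ P, φ p * S p z) / (1 + ∑ p ∈ P, S p z)), ?_, ?_, ?_, ?_⟩
  · refine DifferentiableOn.const_mul (DifferentiableOn.div ?_ ?_ fun z hz h => ?_) _
    · exact hf.add (DifferentiableOn.fun_sum fun p _ => (hSd p).const_mul _)
    · exact (differentiableOn_const _).add (DifferentiableOn.fun_sum fun p _ => hSd p)
    · have := le_norm_one_add_sum (P := P) (S := fun p => S p z) (c₀ := 1 - ω) (by linarith)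
        fun p _ => hSre p z hz
      rw [h, norm_zero] at this
      have h2 : 0 < (1 - ω) * (1 + ∑ p ∈ P, ‖S p z‖) :=
        mul_pos (by linarith) (by positivity)
      linarith
  · exact fun z hz => norm_average_le_one (by linarith) (by linarith) (fun p _ => hSre p z hz)
      (hfb z hz) fun p hp => hφ1 p (hPK hp)
  · intro r hr z hz
    simp only [mem_Ioo, max_lt_iff] at hr
    obtain ⟨⟨hr2, hrd, hrδ⟩, hr1⟩ := hr
    have hz1 : ‖z‖ = 1 := by simpa using hKs hz
    have hzr : ‖(r : ℂ) * z - z‖ = 1 - r := by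
      rw [show (r : ℂ) * z - z = -((1 - r : ℝ) * z) by push_cast; ring, norm_neg, norm_mul, hz1,
        norm_real, Real.norm_of_nonneg (by linarith), mul_one]
    have hrz : (r : ℂ) * z ∈ ball (0 : ℂ) 1 := by
      rw [mem_ball_zero_iff, norm_mul, norm_real, hz1, Real.norm_of_nonneg (by linarith)]; linarith
    have hrU : (r : ℂ) * z ∈ U := hKδ' <| mem_thickening_iff.2 ⟨z, hz, by
      rw [dist_eq_norm, hzr]; linarith⟩
    refine (norm_average_sub_le (e := 3 * ω) (by linarith) (by linarith)
      (fun p _ => hSre p _ hrz) (hφ1 z hz) ?_).trans_lt (by linarith)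
    have hA : 2 ≤ ω * (1 + ∑ p ∈ P, ‖S p (r * z)‖) := by
      obtain ⟨p, hp, hpA⟩ := hSA _ hrU hrz
      have := Finset.single_le_sum (f := fun p => ‖S p (r * z)‖) (fun _ _ => norm_nonneg _) hp
      rw [div_le_iff₀ hω0] at hpA
      nlinarith
    have hsum : ∑ p ∈ P, ‖φ p - φ z‖ * ‖S p (r * z)‖ ≤ ∑ p ∈ P, (ω * ‖S p (r * z)‖ + 2 * κ) := by
      refine Finset.sum_le_sum fun p hp => ?_
      by_cases hfar : d + c ≤ ‖(r : ℂ) * z - p‖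
      · have := mul_le_mul (hterm _ _ (hφ1 p (hPK hp)) (hφ1 z hz)) (hSκ p _ hrz (Or.inl hfar))
          (norm_nonneg _) (by norm_num)
        have : 0 ≤ ω * ‖S p (r * z)‖ := by positivity
        linarith
      · have h2 : dist p z < δ := by
          have := norm_sub_le_norm_sub_add_norm_sub z (r * z) p
          rw [norm_sub_rev z (r * z), hzr] at this
          rw [dist_comm, dist_eq_norm]
          linarith
        have := hφδ p (hPK hp) z hz h2
        rw [dist_eq_norm] at this
        have := mul_le_mul_of_nonneg_right this.le (norm_nonneg (S p (r * z)))
        linarith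
    rw [Finset.sum_add_distrib, ← Finset.mul_sum, Finset.sum_const, nsmul_eq_mul] at hsum
    have := hterm _ _ (hfb _ hrz) (hφ1 z hz)
    have : 0 ≤ ω * ∑ p ∈ P, ‖S p (r * z)‖ := by positivity
    nlinarith
  · intro z hz
    have hz1 := hLD hz
    have hzs : ‖z‖ < s := by simpa using hLs hz
    refine (norm_average_sub_le (e := ω) (by linarith) (by linarith)
      (fun p _ => hSre p _ hz1) (hfb z hz1) ?_).trans_lt (by linarith)
    have hsum : ∑ p ∈ P, ‖φ p - f z‖ * ‖S p z‖ ≤ ∑ p ∈ P, 2 * κ := by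
      refine Finset.sum_le_sum fun p hp => ?_
      exact mul_le_mul (hterm _ _ (hφ1 p (hPK hp)) (hfb z hz1))
        (hSκ p _ hz1 (Or.inr (by linarith))) (norm_nonneg _) (by norm_num)
    rw [Finset.sum_const, nsmul_eq_mul] at hsum
    have : 0 ≤ ω * ∑ p ∈ P, ‖S p z‖ := by positivity
    rw [sub_self, norm_zero]
    linarith

lemma exists_polynomial_near {g : ℂ → ℂ} (hg : DifferentiableOn ℂ g (ball (0 : ℂ) 1))
    (hgb : ∀ z ∈ ball (0 : ℂ) 1, ‖g z‖ ≤ 1) {s : ℝ} (hs : s < 1) {ε : ℝ} (hε : 0 < ε) :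
    ∃ (p : Polynomial ℂ) (m : ℝ), m < 1 ∧ (∀ z ∈ closedBall (0 : ℂ) 1, ‖p.eval z‖ ≤ m) ∧
      ∀ z ∈ closedBall (0 : ℂ) s, ‖p.eval z - g z‖ < ε := by
  obtain ⟨δ, hδ0, hδ1, hδε⟩ : ∃ δ : ℝ, 0 < δ ∧ δ < 1 ∧ 4 * δ < ε :=
    ⟨min (ε / 8) (1 / 2), by positivity, by linarith [min_le_right (ε / 8) (1 / 2 : ℝ)],
      by linarith [min_le_left (ε / 8) (1 / 2 : ℝ)]⟩
  obtain ⟨γ, hγ, hgγ⟩ := Metric.uniformContinuousOn_iff.1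
    ((isCompact_closedBall (0 : ℂ) s).uniformContinuousOn_of_continuous
      (hg.continuousOn.mono (closedBall_subset_ball hs))) δ hδ0
  obtain ⟨t, ht0, ht1, htγ⟩ : ∃ t : ℝ, 0 < t ∧ t < 1 ∧ 1 - t < γ :=
    ⟨max (1 / 2) (1 - γ / 2), by positivity, max_lt (by norm_num) (by linarith),
      by linarith [le_max_right (1 / 2) (1 - γ / 2)]⟩
  obtain ⟨t₁, htt₁, ht₁⟩ := exists_between ht1
  obtain ⟨t₂, htt₂, ht₂⟩ := exists_between ht₁
  lift t₁ to NNReal using by linarith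
  lift t₂ to NNReal using by linarith
  have hps := (hg.mono (closedBall_subset_ball ht₂)).hasFPowerSeriesOnBall
    (show 0 < t₂ from lt_of_le_of_lt (zero_le (a := t₁)) (by exact_mod_cast htt₂))
  obtain ⟨n, hn⟩ := (Metric.tendstoUniformlyOn_iff.1
    (hps.tendstoUniformlyOn (r' := t₁) (by exact_mod_cast htt₂)) (δ / 2) (by positivity)).exists
  set q := cauchyPowerSeries g 0 t₂
  refine ⟨∑ k ∈ Finset.range n, Polynomial.C (((1 - δ : ℝ) : ℂ) * t ^ k * q.coeff k) * Polynomial.X ^ k,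
    1 - δ / 2, by linarith, ?_⟩
  have heval : ∀ z, (∑ k ∈ Finset.range n,
      Polynomial.C (((1 - δ : ℝ) : ℂ) * t ^ k * q.coeff k) * Polynomial.X ^ k).eval z =
      ((1 - δ : ℝ) : ℂ) * q.partialSum n (t * z) := fun z => by
    rw [Polynomial.eval_finsetSum, FormalMultilinearSeries.partialSum, Finset.mul_sum]
    refine Finset.sum_congr rfl fun k _ => ?_
    rw [FormalMultilinearSeries.apply_eq_pow_smul_coeff]
    simp only [Polynomial.eval_mul, Polynomial.eval_C, Polynomial.eval_pow, Polynomial.eval_X,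
      smul_eq_mul]
    ring
  have htz : ∀ z ∈ closedBall (0 : ℂ) 1, ‖(t : ℂ) * z‖ ≤ t := fun z hz => by
    rw [norm_mul, norm_real, Real.norm_of_nonneg ht0.le]
    exact mul_le_of_le_one_right ht0.le (by simpa using hz)
  have hclose : ∀ z ∈ closedBall (0 : ℂ) 1,
      ‖((1 - δ : ℝ) : ℂ) * q.partialSum n (t * z) - (1 - δ : ℝ) * g (t * z)‖ ≤ δ / 2 := fun z hz => by
    have := hn (t * z) (by rw [mem_ball_zero_iff]; exact (htz z hz).trans_lt htt₁)
    rw [zero_add, dist_comm, dist_eq_norm] at this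
    rw [← mul_sub, norm_mul, norm_real, Real.norm_of_nonneg (by linarith)]
    nlinarith [norm_nonneg (q.partialSum n (t * z) - g (t * z))]
  have hgt : ∀ z ∈ closedBall (0 : ℂ) 1, ‖g (t * z)‖ ≤ 1 := fun z hz =>
    hgb _ (by rw [mem_ball_zero_iff]; exact (htz z hz).trans_lt ht1)
  refine ⟨fun z hz => ?_, fun z hz => ?_⟩
  · rw [heval]
    have h1 : ‖((1 - δ : ℝ) : ℂ) * g (t * z)‖ ≤ 1 - δ := by
      rw [norm_mul, norm_real, Real.norm_of_nonneg (by linarith)]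
      exact mul_le_of_le_one_right (by linarith) (hgt z hz)
    have := norm_le_norm_add_norm_sub' (((1 - δ : ℝ) : ℂ) * q.partialSum n (t * z))
      ((1 - δ : ℝ) * g (t * z))
    linarith [hclose z hz]
  · rw [heval]
    have hz1 : z ∈ closedBall (0 : ℂ) 1 := closedBall_subset_closedBall hs.le hz
    have hz1' : ‖z‖ ≤ 1 := by simpa using hz1
    have hzs : ‖z‖ ≤ s := by simpa using hz
    have h1 : dist (g (t * z)) (g z) < δ := by
      refine hgγ _ ?_ _ hz ?_
      · rw [mem_closedBall_zero_iff, norm_mul, norm_real, Real.norm_of_nonneg ht0.le]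
        nlinarith [norm_nonneg z]
      · rw [dist_eq_norm, show (t : ℂ) * z - z = -((1 - t : ℝ) * z) by push_cast; ring, norm_neg,
          norm_mul, norm_real, Real.norm_of_nonneg (by linarith)]
        nlinarith [norm_nonneg z]
    rw [dist_eq_norm] at h1
    have h2 : ‖((1 - δ : ℝ) : ℂ) * g (t * z) - g (t * z)‖ ≤ δ := by
      rw [show ((1 - δ : ℝ) : ℂ) * g (t * z) - g (t * z) = -((δ : ℝ) * g (t * z)) by push_cast; ring,
        norm_neg, norm_mul, norm_real, Real.norm_of_nonneg hδ0.le]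
      exact mul_le_of_le_one_right hδ0.le (hgt z hz1)
    have h3 := hclose z hz1
    have := norm_sub_le_norm_sub_add_norm_sub (((1 - δ : ℝ) : ℂ) * q.partialSum n (t * z))
      ((1 - δ : ℝ) * g (t * z)) (g z)
    have := norm_sub_le_norm_sub_add_norm_sub (((1 - δ : ℝ) : ℂ) * g (t * z)) (g (t * z)) (g z)
    linarith

/-- The value `∑ conj aₖ · z ^ (n - k)` of the conjugate reciprocal of `p = ∑ aₖ Xᵏ`. -/
def conjReverseEval (p : Polynomial ℂ) (z : ℂ) : ℂ :=
  ∑ k ∈ Finset.range (p.natDegree + 1),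
    (starRingEnd ℂ) (p.coeff k) * z ^ (p.natDegree - k)

lemma conjReverseEval_eq (p : Polynomial ℂ) {z : ℂ} (hz : z ≠ 0) :
    conjReverseEval p z =
      z ^ p.natDegree * (starRingEnd ℂ) (p.eval ((starRingEnd ℂ) z)⁻¹) := by
  rw [conjReverseEval, Polynomial.eval_eq_sum_range, map_sum, Finset.mul_sum]
  refine Finset.sum_congr rfl fun k hk => ?_
  rw [pow_sub₀ _ hz (Nat.lt_succ_iff.1 (Finset.mem_range.1 hk))]
  simp only [map_mul, map_pow, map_inv₀, conj_conj, inv_pow]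
  ring

lemma norm_conjReverseEval_le {p : Polynomial ℂ} {m : ℝ}
    (hp : ∀ z ∈ closedBall (0 : ℂ) 1, ‖p.eval z‖ ≤ m) {z : ℂ} (hz : ‖z‖ ≤ 1) :
    ‖conjReverseEval p z‖ ≤ m := by
  have hd : Differentiable ℂ (conjReverseEval p) := by unfold conjReverseEval; fun_prop
  refine norm_le_of_forall_mem_frontier_norm_le (U := ball (0 : ℂ) 1) isBounded_ball hd.diffContOnCl
    (fun w hw => ?_) (by rw [closure_ball _ one_ne_zero]; simpa using hz)
  rw [frontier_ball _ one_ne_zero, mem_sphere_zero_iff_norm] at hw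
  have hw0 : w ≠ 0 := by rintro rfl; simp at hw
  rw [conjReverseEval_eq p hw0, norm_mul, norm_pow, hw, one_pow, one_mul, norm_conj]
  exact hp _ (by simp [hw])

lemma exists_eval_eq_prod_sub {Q : Polynomial ℂ} (hQ : Q.Monic) {n : ℕ} (hn : Q.natDegree = n) :
    ∃ w : Fin n → ℂ, ∀ z, Q.eval z = ∏ k, (z - w k) := by
  have hs := IsAlgClosed.splits Q
  have hcard : Q.roots.toList.length = n := by
    rw [Multiset.length_toList, ← hs.natDegree_eq_card_roots, hn]
  subst hcard
  refine ⟨fun i => Q.roots.toList[i.1], fun z => ?_⟩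
  rw [hs.eval_eq_prod_roots_of_monic hQ, Fin.prod_univ_fun_getElem _ fun a => z - a,
    ← Multiset.prod_coe, ← Multiset.map_coe, Multiset.coe_toList]

lemma exists_blaschke_near_polynomial {p : Polynomial ℂ} {m : ℝ} (hm : m < 1)
    (hp : ∀ z ∈ closedBall (0 : ℂ) 1, ‖p.eval z‖ ≤ m) {s : ℝ} (hs : s < 1) {ε : ℝ} (hε : 0 < ε) :
    ∃ B, IsFiniteBlaschke B ∧ ∀ z ∈ closedBall (0 : ℂ) s, ‖B z - p.eval z‖ < ε := by
  have hm0 : 0 ≤ m := (norm_nonneg _).trans (hp 0 (by simp))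
  wlog hs0 : 0 ≤ s generalizing s
  · obtain ⟨B, hB, h⟩ := this zero_lt_one le_rfl
    exact ⟨B, hB, fun z hz => h z (closedBall_subset_closedBall (by linarith) hz)⟩
  obtain ⟨k, hk⟩ := exists_pow_lt_of_lt_one (show 0 < ε * (1 - m) / 2 by
    have : 0 < 1 - m := by linarith
    positivity) hs
  set n := p.natDegree with hn
  have hdeg : p.degree < ((n + k + 1 : ℕ) : WithBot ℕ) :=
    p.degree_le_natDegree.trans_lt (by exact_mod_cast (by omega))
  set Q : Polynomial ℂ := Polynomial.X ^ (n + k + 1) + p with hQ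
  have hQm : Q.Monic := Polynomial.monic_X_pow_add hdeg
  have hQd : Q.natDegree = n + k + 1 := by
    rw [hQ, Polynomial.natDegree_add_eq_left_of_natDegree_lt] <;> (simp; try omega)
  have hQe : ∀ z, Q.eval z = z ^ (n + k + 1) + p.eval z := fun z => by simp [hQ]
  obtain ⟨w, hw⟩ := exists_eval_eq_prod_sub hQm hQd
  have hw1 : ∀ j, ‖w j‖ < 1 := fun j => by
    by_contra! h
    have hw0 : w j ≠ 0 := by intro h0; simp [h0] at h; linarith
    have h1 : (w j) ^ (n + k + 1) + p.eval (w j) = 0 := by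
      rw [← hQe, hw]; exact Finset.prod_eq_zero (Finset.mem_univ j) (sub_self _)
    have h2 := norm_conjReverseEval_le hp (z := ((starRingEnd ℂ) (w j))⁻¹)
      (by rw [norm_inv, norm_conj]; exact inv_le_one_of_one_le₀ h)
    rw [conjReverseEval_eq p (by simpa using hw0)] at h2
    simp only [map_inv₀, conj_conj, inv_inv, norm_mul, norm_pow, norm_inv, norm_conj, ← hn,
      eq_neg_of_add_eq_zero_right h1, map_neg, map_pow, norm_neg] at h2
    rw [show n + k + 1 = n + (k + 1) by ring, pow_add, inv_pow, inv_mul_cancel_left₀ (by positivity)] at h2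
    linarith [one_le_pow₀ h (n := k + 1)]
  have hden : ∀ z, ∏ j, (1 - (starRingEnd ℂ) (w j) * z) = 1 + z ^ (k + 1) * conjReverseEval p z := by
    intro z
    rcases eq_or_ne z 0 with rfl | hz
    · simp
    · have h1 : ∏ j, (1 - (starRingEnd ℂ) (w j) * z) =
          z ^ (n + k + 1) * (starRingEnd ℂ) (Q.eval ((starRingEnd ℂ) z)⁻¹) := by
        rw [hw, map_prod, ← Fin.prod_const, ← Finset.prod_mul_distrib]
        refine Finset.prod_congr rfl fun j _ => ?_
        simp only [map_sub, map_inv₀, conj_conj]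
        field_simp
      rw [h1, hQe, conjReverseEval_eq p hz, ← hn]
      simp only [map_add, map_pow, map_inv₀, conj_conj, inv_pow, mul_add]
      rw [mul_inv_cancel₀ (pow_ne_zero _ hz)]
      ring
  refine ⟨fun z => 1 * ∏ j, (z - w j) / (1 - (starRingEnd ℂ) (w j) * z),
    ⟨n + k, 1, w, norm_one, hw1, fun z => rfl⟩, fun z hz => ?_⟩
  have hzs : ‖z‖ ≤ s := by simpa using hz
  have hq := norm_conjReverseEval_le hp (hzs.trans hs.le)
  have hpz := hp z (closedBall_subset_closedBall hs.le hz)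
  have hzk : ‖z‖ ^ (k + 1) ≤ s ^ k := by
    calc ‖z‖ ^ (k + 1) ≤ s ^ (k + 1) := by gcongr
      _ ≤ s ^ k := pow_le_pow_of_le_one hs0 hs.le (by omega)
  have hzk1 : ‖z‖ ^ (k + 1) ≤ 1 := pow_le_one₀ (norm_nonneg _) (hzs.trans hs.le)
  have hD : 1 - m ≤ ‖1 + z ^ (k + 1) * conjReverseEval p z‖ := by
    have h1 := norm_sub_le_norm_add (1 : ℂ) (z ^ (k + 1) * conjReverseEval p z)
    rw [norm_one, norm_mul, norm_pow] at h1
    have : ‖z‖ ^ (k + 1) * ‖conjReverseEval p z‖ ≤ 1 * m := by gcongr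
    linarith
  have hD0 : 0 < ‖1 + z ^ (k + 1) * conjReverseEval p z‖ := by linarith
  have hne := norm_pos_iff.1 hD0
  simp only [one_mul]
  rw [Finset.prod_div_distrib, hden, ← hw, hQe, div_sub' hne, norm_div, div_lt_iff₀ hD0]
  calc _ = ‖z ^ (k + 1) * (z ^ n - p.eval z * conjReverseEval p z)‖ := by congr 1; ring
    _ ≤ s ^ k * (1 + 1 * 1) := by
      rw [norm_mul, norm_pow]
      gcongr
      refine (norm_sub_le _ _).trans (add_le_add ?_ ?_)
      · rw [norm_pow]; exact pow_le_one₀ (norm_nonneg _) (hzs.trans hs.le)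
      · rw [norm_mul]; gcongr <;> linarith
    _ < ε * (1 - m) := by linarith
    _ ≤ _ := by gcongr

/-- Simultaneous approximation with dilates: for `φ` in the closed unit ball of `C(K)` there is
`r₀ ∈ (0,1)` such that for every `r ∈ (r₀,1)` some finite Blaschke product `B` satisfies
`‖B(rz) − φ(z)‖ < ε` on `K` and `‖B − f‖ < ε` on `L`. -/
theorem simultaneous_approx_disc (K : Set ℂ) (hKc : IsCompact K)
    (hKs : K ⊆ Metric.sphere (0:ℂ) 1) (hK0 : arclength K = 0)
    (L : Set ℂ) (hLc : IsCompact L) (hLD : L ⊆ Metric.ball (0:ℂ) 1)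
    (φ : ℂ → ℂ) (hφc : ContinuousOn φ K) (hφ1 : ∀ z ∈ K, ‖φ z‖ ≤ 1)
    (f : ℂ → ℂ) (hf : DifferentiableOn ℂ f (Metric.ball (0:ℂ) 1))
    (hfb : ∀ z ∈ Metric.ball (0:ℂ) 1, ‖f z‖ ≤ 1)
    (ε : ℝ) (hε : 0 < ε) :
    ∃ r₀ ∈ Set.Ioo (0:ℝ) 1, ∀ r ∈ Set.Ioo r₀ 1,
      ∃ B : ℂ → ℂ, IsFiniteBlaschke B ∧
        (∀ z ∈ K, ‖B ((r : ℂ) * z) - φ z‖ < ε) ∧ (∀ z ∈ L, ‖B z - f z‖ < ε) := by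
  obtain ⟨r₀, hr₀, g, hg, hgb, hgK, hgL⟩ :=
    exists_holomorphic_near hKc hKs hK0 hLc hLD hφc hφ1 hf hfb (half_pos hε)
  refine ⟨r₀, hr₀, fun r hr => ?_⟩
  obtain ⟨s₁, hs₁, hLs⟩ := exists_lt_subset_ball hLc.isClosed hLD
  have hs : max s₁ r < 1 := max_lt hs₁ hr.2
  obtain ⟨p, m, hm, hpm, hpg⟩ := exists_polynomial_near hg hgb hs (ε := ε / 4) (by positivity)
  obtain ⟨B, hB, hBp⟩ := exists_blaschke_near_polynomial hm hpm hs (ε := ε / 4) (by positivity)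
  have hBg : ∀ z ∈ closedBall (0 : ℂ) (max s₁ r), ‖B z - g z‖ < ε / 2 := fun z hz => by
    have := norm_sub_le_norm_sub_add_norm_sub (B z) (p.eval z) (g z)
    linarith [hBp z hz, hpg z hz]
  refine ⟨B, hB, fun z hz => ?_, fun z hz => ?_⟩
  · have hz1 : ‖z‖ = 1 := by simpa using hKs hz
    have h1 := hBg (r * z) (by
      rw [mem_closedBall_zero_iff, norm_mul, hz1, norm_real,
        Real.norm_of_nonneg (hr₀.1.trans hr.1).le, mul_one]
      exact le_max_right _ _)
    have := norm_sub_le_norm_sub_add_norm_sub (B (r * z)) (g (r * z)) (φ z)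
    linarith [hgK r hr z hz]
  · have h1 := hBg z (closedBall_subset_closedBall (le_max_left _ _)
      (ball_subset_closedBall (hLs hz)))
    have := norm_sub_le_norm_sub_add_norm_sub (B z) (g z) (f z)
    linarith [hgL z hz]
end
end

section
/- Let K be a compact subset of the unit circle of arclength measure 0 and L a compact subset of the open unit disc. Let φ : K → ℂ be continuous with |φ| ≡ 1 on K and let ε > 0. Then there exists a finite Blaschke product B such that sup_{z∈K} |B(z) − φ(z)| < ε and sup_{z∈L} |B(z) − 1| < ε. -/
open Complex Metric MeasureTheory Filter Set

noncomputable section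

theorem exists_partial_fractions (S : Finset (ℝ × ℝ)) (hlt : ∀ q ∈ S, q.1 < q.2)
    (hdis : (S : Set (ℝ × ℝ)).PairwiseDisjoint fun q => Icc q.1 q.2) :
    ∃ c : ℝ × ℝ → ℝ, (∀ q ∈ S, 0 ≤ c q) ∧ ∑ q ∈ S, c q = ∑ q ∈ S, (q.2 - q.1) ∧
      ∀ x : ℂ, (∀ q ∈ S, x ≠ q.1) →
        ∏ q ∈ S, (x - q.2) / (x - q.1) = 1 - ∑ q ∈ S, c q / (x - q.1) := by
  classical
  induction S using Finset.induction_on with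
  | empty => exact ⟨fun _ => 0, by simp⟩
  | insert p S hp ih =>
    obtain ⟨c, hc0, hcs, hc⟩ := ih (fun q hq => hlt q (Finset.mem_insert_of_mem hq))
      (hdis.subset (by simp))
    have hsep : ∀ q ∈ S, q.2 < p.1 ∨ p.2 < q.1 := by
      intro q hq
      have hne : q ≠ p := fun h => hp (h ▸ hq)
      have hd := hdis (by simp [hq]) (by simp) hne
      by_contra! hcon
      have h1 := hlt q (by simp [hq])
      have h2 := hlt p (by simp)
      exact Set.disjoint_left.mp hd
        (show max q.1 p.1 ∈ Icc q.1 q.2 from ⟨le_max_left _ _, max_le h1.le hcon.1⟩)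
        ⟨le_max_right _ _, max_le hcon.2 h2.le⟩
    have hplt := hlt p (by simp)
    have hne : ∀ q ∈ S, q.1 ≠ p.1 := by
      intro q hq h
      have h1 := hlt q (by simp [hq])
      rcases hsep q hq with h' | h' <;> linarith
    have hpa : ∀ q ∈ S, (p.1 : ℂ) ≠ q.1 := fun q hq h => hne q hq (by exact_mod_cast h.symm)
    have hQ := hc p.1 hpa
    have hQr : ∏ q ∈ S, (p.1 - q.2) / (p.1 - q.1) = 1 - ∑ q ∈ S, c q / (p.1 - q.1) := by
      exact_mod_cast hQ
    let c' : ℝ × ℝ → ℝ := fun q =>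
      if q = p then (p.2 - p.1) * ∏ q ∈ S, (p.1 - q.2) / (p.1 - q.1)
      else c q * ((q.1 - p.2) / (q.1 - p.1))
    have hcp : c' p = (p.2 - p.1) * (1 - ∑ q ∈ S, c q / (p.1 - q.1)) := by
      simp only [c', if_true, hQr]
    have hcq : ∀ q ∈ S, c' q = c q * ((q.1 - p.2) / (q.1 - p.1)) := by
      intro q hq
      have : q ≠ p := fun h => hp (h ▸ hq)
      simp [c', this]
    refine ⟨c', ?_, ?_, ?_⟩
    · intro q hq
      rcases Finset.mem_insert.mp hq with rfl | hq
      · simp only [c', if_true]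
        refine mul_nonneg (by linarith) (Finset.prod_nonneg fun r hr => ?_)
        have h1 := hlt r (by simp [hr])
        rcases hsep r hr with h | h
        · exact div_nonneg (by linarith) (by linarith)
        · exact div_nonneg_of_nonpos (by linarith) (by linarith)
      · rw [hcq q hq]
        refine mul_nonneg (hc0 q hq) ?_
        have h1 := hlt q (by simp [hq])
        rcases hsep q hq with h | h
        · exact div_nonneg_of_nonpos (by linarith) (by linarith)
        · exact div_nonneg (by linarith) (by linarith)
    · rw [Finset.sum_insert hp, Finset.sum_insert hp, hcp, Finset.sum_congr rfl hcq, ← hcs,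
        mul_sub, Finset.mul_sum, mul_one, sub_add, ← Finset.sum_sub_distrib, sub_eq_add_neg,
        ← Finset.sum_neg_distrib]
      congr 1
      refine Finset.sum_congr rfl fun q hq => ?_
      have h1 : q.1 - p.1 ≠ 0 := sub_ne_zero.mpr (hne q hq)
      have h2 : p.1 - q.1 ≠ 0 := sub_ne_zero.mpr (hne q hq).symm
      field_simp
      ring
    · intro x hx
      have hxp : x - p.1 ≠ 0 := sub_ne_zero.mpr (hx p (by simp))
      have hxS : ∀ q ∈ S, x ≠ q.1 := fun q hq => hx q (by simp [hq])
      rw [Finset.prod_insert hp, Finset.sum_insert hp, hc x hxS, hcp]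
      have h1 : ∀ q ∈ S, ((c' q : ℝ) : ℂ) / (x - q.1) = c q / (x - q.1)
          - (p.2 - p.1) / (x - p.1) * (c q / (x - q.1))
          + (p.2 - p.1) / (x - p.1) * (c q / (p.1 - q.1)) := by
        intro q hq
        rw [hcq q hq]
        push_cast
        have h1 : (q.1 : ℂ) - p.1 ≠ 0 := sub_ne_zero.mpr (hpa q hq).symm
        have h2 : (p.1 : ℂ) - q.1 ≠ 0 := sub_ne_zero.mpr (hpa q hq)
        have h3 : x - q.1 ≠ 0 := sub_ne_zero.mpr (hxS q hq)
        field_simp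
        ring
      rw [Finset.sum_congr rfl h1, Finset.sum_add_distrib, Finset.sum_sub_distrib,
        ← Finset.mul_sum, ← Finset.mul_sum]
      push_cast
      field_simp
      ring

theorem exists_disjoint_interval_cover {K : Set ℝ} (hK : IsCompact K) (hK0 : volume K = 0)
    {η : ℝ} (hη : 0 < η) :
    ∃ S : Finset (ℝ × ℝ), (∀ q ∈ S, q.1 < q.2) ∧ (∀ q ∈ S, q.2 - q.1 < η) ∧
      (∀ q ∈ S, ∃ t ∈ K, t ∈ Ioo q.1 q.2) ∧
      (S : Set (ℝ × ℝ)).PairwiseDisjoint (fun q => Icc q.1 q.2) ∧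
      (∀ t ∈ K, ∃ q ∈ S, t ∈ Ioo q.1 q.2) ∧ ∑ q ∈ S, (q.2 - q.1) < η := by
  classical
  obtain ⟨r, hr0, hrη, hr⟩ : ∃ r : ℝ, 0 < r ∧ r < η ∧
      volume (cthickening r K) < ENNReal.ofReal η := by
    have h := tendsto_measure_cthickening_of_isCompact (μ := volume) hK
    rw [hK0] at h
    have h1 : ∀ᶠ r in nhdsWithin (0 : ℝ) (Ioi 0), volume (cthickening r K) < ENNReal.ofReal η :=
      (h.eventually_lt_const (ENNReal.ofReal_pos.mpr hη)).filter_mono nhdsWithin_le_nhds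
    obtain ⟨r, h2, h3, h4⟩ := (h1.and ((Ioo_mem_nhdsGT hη))).exists
    exact ⟨r, h3, h4, h2⟩
  set h : ℝ := r / 2 with hh
  have hpos : 0 < h := by positivity
  have hg : ∀ k : ℤ, ∃ g ∈ Ioo (k * h) ((k + 1) * h), g ∉ K := by
    intro k
    by_contra! hcon
    have h1 : volume (Ioo (k * h) ((k + 1) * h)) ≤ 0 := hK0 ▸ measure_mono hcon
    rw [Real.volume_Ioo] at h1
    have : (k + 1) * h - k * h = h := by ring
    rw [this] at h1
    simp at h1
    linarith
  choose g hgI hgK using hg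
  have hgstep : ∀ k l : ℤ, k < l → g k < g l := by
    intro k l hkl
    have h1 : (k : ℝ) + 1 ≤ l := by exact_mod_cast hkl
    have h2 := (hgI k).2
    have h3 := (hgI l).1
    nlinarith
  have hgmono : StrictMono g := fun k l => hgstep k l
  have hb : ∀ k : ℤ, ∃ b ∈ Ioo (g k) (g (k + 1)), ∀ t ∈ K, t ∈ Icc (g k) (g (k + 1)) → t < b := by
    intro k
    have hlt : g k < g (k + 1) := hgmono (by omega)
    rcases (K ∩ Icc (g k) (g (k + 1))).eq_empty_or_nonempty with he | hne
    · refine ⟨(g k + g (k + 1)) / 2, ⟨by linarith, by linarith⟩, fun t ht hti => ?_⟩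
      exact absurd (show t ∈ K ∩ Icc (g k) (g (k + 1)) from ⟨ht, hti⟩) (by simp [he])
    · obtain ⟨m, ⟨hmK, hmI⟩, hm⟩ := (hK.inter_right isClosed_Icc).exists_isGreatest hne
      have hm1 : m < g (k + 1) := lt_of_le_of_ne hmI.2 fun h => hgK _ (h ▸ hmK)
      refine ⟨(m + g (k + 1)) / 2, ⟨by linarith [hmI.1], by linarith⟩, fun t ht hti => ?_⟩
      have := hm ⟨ht, hti⟩
      linarith
  choose b hbI hbK using hb
  have hlen : ∀ k, b k - g k < r := by
    intro k
    have h1 := (hbI k).2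
    have h2 := (hgI k).1
    have h3 := (hgI (k + 1)).2
    push_cast at h3
    have : r = 2 * h := by rw [hh]; ring
    nlinarith
  have hfin : {k : ℤ | ∃ t ∈ K, t ∈ Ioo (g k) (b k)}.Finite := by
    obtain ⟨M, hM⟩ := hK.isBounded.subset_closedBall 0
    refine (Set.finite_Icc (⌊-M / h⌋ - 2) (⌈M / h⌉)).subset ?_
    rintro k ⟨t, htK, ht⟩
    have h1 := hM htK
    rw [mem_closedBall_zero_iff, Real.norm_eq_abs, abs_le] at h1
    have h2 := (hgI k).1
    have h3 := (hgI (k + 1)).2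
    push_cast at h3
    have h4 := (hbI k).2
    have h5 : (k : ℝ) < M / h := by rw [lt_div_iff₀ hpos]; linarith [ht.1]
    have h6 : -M / h < k + 2 := by rw [div_lt_iff₀ hpos]; nlinarith [ht.2]
    have h7 : (k : ℝ) ≤ ⌈M / h⌉ := h5.le.trans (Int.le_ceil _)
    have h8 : (⌊-M / h⌋ : ℝ) ≤ k + 2 := (Int.floor_le _).trans h6.le
    constructor
    · have : ⌊-M / h⌋ ≤ k + 2 := by exact_mod_cast h8
      omega
    · exact_mod_cast h7
  have hinj : Function.Injective fun k => (g k, b k) := fun k l hkl =>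
    hgmono.injective (Prod.ext_iff.mp hkl).1
  have hdis : ∀ k l : ℤ, k ≠ l → Disjoint (Icc (g k) (b k)) (Icc (g l) (b l)) := by
    have key : ∀ k l : ℤ, k < l → Disjoint (Icc (g k) (b k)) (Icc (g l) (b l)) := by
      intro k l hkl
      refine Set.disjoint_left.mpr fun t h1 h2 => ?_
      have h3 : g (k + 1) ≤ g l := hgmono.monotone hkl
      linarith [h1.2, h2.1, (hbI k).2]
    intro k l hkl
    rcases lt_or_gt_of_ne hkl with h | h
    · exact key k l h
    · exact (key l k h).symm
  refine ⟨hfin.toFinset.image fun k => (g k, b k), ?_, ?_, ?_, ?_, ?_, ?_⟩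
  · simp only [Finset.forall_mem_image]
    exact fun k _ => (hbI k).1
  · simp only [Finset.forall_mem_image]
    exact fun k _ => (hlen k).trans hrη
  · simp only [Finset.forall_mem_image]
    exact fun k hk => by simpa using hk
  · intro q hq q' hq' hne
    obtain ⟨k, -, rfl⟩ := Finset.mem_image.mp (Finset.mem_coe.mp hq)
    obtain ⟨l, -, rfl⟩ := Finset.mem_image.mp (Finset.mem_coe.mp hq')
    exact hdis k l fun h => hne (by rw [h])
  · intro t ht
    have hex : ∃ k, g k ≤ t ∧ t ≤ g (k + 1) := by
      have h1 : (⌊t / h⌋ : ℝ) * h ≤ t := by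
        rw [← le_div_iff₀ hpos]; exact Int.floor_le _
      have h2 : t < (⌊t / h⌋ + 1 : ℝ) * h := by
        rw [← div_lt_iff₀ hpos]; exact Int.lt_floor_add_one _
      rcases le_total (g ⌊t / h⌋) t with h3 | h3
      · refine ⟨_, h3, ?_⟩
        have := (hgI (⌊t / h⌋ + 1)).1
        push_cast at this
        linarith
      · refine ⟨⌊t / h⌋ - 1, ?_, by simpa using h3⟩
        have := (hgI (⌊t / h⌋ - 1)).2
        push_cast at this
        rw [sub_add_cancel] at this
        linarith
    obtain ⟨k, hk1, hk2⟩ := hex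
    have hI : t ∈ Ioo (g k) (b k) :=
      ⟨lt_of_le_of_ne hk1 fun h => hgK k (h ▸ ht), hbK k t ht ⟨hk1, hk2⟩⟩
    exact ⟨(g k, b k), Finset.mem_image_of_mem _ (by simpa using ⟨t, ht, hI⟩), hI⟩
  · rw [Finset.sum_image hinj.injOn]
    have h1 : volume (⋃ k ∈ hfin.toFinset, Icc (g k) (b k)) =
        ∑ k ∈ hfin.toFinset, volume (Icc (g k) (b k)) :=
      measure_biUnion_finset (fun k _ l _ hkl => hdis k l hkl) fun _ _ => measurableSet_Icc
    have h2 : (⋃ k ∈ hfin.toFinset, Icc (g k) (b k)) ⊆ cthickening r K := by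
      refine iUnion₂_subset fun k hk x hx => ?_
      obtain ⟨t, ht, htI⟩ : ∃ t ∈ K, t ∈ Ioo (g k) (b k) := by simpa using hk
      refine mem_cthickening_of_dist_le x t r K ht ?_
      rw [Real.dist_eq, abs_le]
      constructor <;> linarith [hx.1, hx.2, htI.1, htI.2, hlen k]
    have h3 := (measure_mono h2).trans_lt hr
    rw [h1] at h3
    simp only [Real.volume_Icc] at h3
    rw [← ENNReal.ofReal_sum_of_nonneg fun k _ => by linarith [(hbI k).1]] at h3
    exact (ENNReal.ofReal_lt_ofReal_iff hη).mp h3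

/-- The Blaschke product of the upper half-plane with zeros `s`. -/
def halfPlaneBlaschke (s : Multiset ℂ) (x : ℂ) : ℂ :=
  (s.map fun w => (x - w) / (x - (starRingEnd ℂ) w)).prod

theorem halfPlaneBlaschke_add (s t : Multiset ℂ) (x : ℂ) :
    halfPlaneBlaschke (s + t) x = halfPlaneBlaschke s x * halfPlaneBlaschke t x := by
  simp [halfPlaneBlaschke]

theorem halfPlaneBlaschke_sum {ι : Type*} (S : Finset ι) (s : ι → Multiset ℂ) (x : ℂ) :
    halfPlaneBlaschke (∑ i ∈ S, s i) x = ∏ i ∈ S, halfPlaneBlaschke (s i) x := by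
  classical
  induction S using Finset.induction_on with
  | empty => simp [halfPlaneBlaschke]
  | insert i S hi ih => rw [Finset.sum_insert hi, Finset.prod_insert hi, halfPlaneBlaschke_add, ih]

theorem norm_halfPlaneBlaschke_le_one {s : Multiset ℂ} (hs : ∀ w ∈ s, 0 < w.im) {x : ℂ}
    (hx : 0 ≤ x.im) : ‖halfPlaneBlaschke s x‖ ≤ 1 := by
  induction s using Multiset.induction_on with
  | empty => simp [halfPlaneBlaschke]
  | cons w s ih =>
    have h1 : ‖x - w‖ ≤ ‖x - (starRingEnd ℂ) w‖ := by
      rw [← sq_le_sq₀ (norm_nonneg _) (norm_nonneg _), ← normSq_eq_norm_sq, ← normSq_eq_norm_sq,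
        normSq_apply, normSq_apply]
      simp only [sub_re, sub_im, conj_re, conj_im]
      nlinarith [hs w (by simp)]
    have h2 := ih fun w hw => hs w (Multiset.mem_cons_of_mem hw)
    rw [halfPlaneBlaschke] at h2 ⊢
    rw [Multiset.map_cons, Multiset.prod_cons, norm_mul, norm_div]
    exact mul_le_one₀ (div_le_one_of_le₀ h1 (norm_nonneg _)) (norm_nonneg _) h2

theorem norm_prod_sub_prod_le_sum {ι : Type*} (S : Finset ι) (f g : ι → ℂ)
    (hf : ∀ i ∈ S, ‖f i‖ ≤ 1) (hg : ∀ i ∈ S, ‖g i‖ ≤ 1) :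
    ‖∏ i ∈ S, f i - ∏ i ∈ S, g i‖ ≤ ∑ i ∈ S, ‖f i - g i‖ := by
  classical
  induction S using Finset.induction_on with
  | empty => simp
  | insert i S hi ih =>
    have ih' := ih (fun j hj => hf j (by simp [hj])) fun j hj => hg j (by simp [hj])
    rw [Finset.prod_insert hi, Finset.prod_insert hi, Finset.sum_insert hi]
    have hp : ‖∏ i ∈ S, f i‖ ≤ 1 := by
      rw [norm_prod]
      exact Finset.prod_le_one (fun _ _ => norm_nonneg _) fun j hj => hf j (by simp [hj])
    calc ‖f i * ∏ i ∈ S, f i - g i * ∏ i ∈ S, g i‖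
        = ‖(f i - g i) * ∏ i ∈ S, f i + g i * (∏ i ∈ S, f i - ∏ i ∈ S, g i)‖ := by ring_nf
      _ ≤ ‖f i - g i‖ * ‖∏ i ∈ S, f i‖ + ‖g i‖ * ‖∏ i ∈ S, f i - ∏ i ∈ S, g i‖ := by
        rw [← norm_mul, ← norm_mul]; exact norm_add_le _ _
      _ ≤ ‖f i - g i‖ * 1 + 1 * ‖∏ i ∈ S, f i - ∏ i ∈ S, g i‖ := by
        gcongr; exact hg i (by simp)
      _ ≤ _ := by linarith

/-- The Möbius image of `1 - ∏ (x - b) / (x - a)` under `s ↦ (1 + conj C * s) / (1 + C * s)` is a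
half-plane Blaschke product. -/
theorem exists_halfPlaneBlaschke_eq (S : Finset (ℝ × ℝ)) (hS : S.Nonempty)
    (hlt : ∀ q ∈ S, q.1 < q.2)
    (hdis : (S : Set (ℝ × ℝ)).PairwiseDisjoint fun q => Icc q.1 q.2) {C : ℂ} (hC : 0 < C.im) :
    ∃ s : Multiset ℂ, s ≠ 0 ∧ (∀ w ∈ s, 0 < w.im) ∧ ∀ x : ℂ, (∀ q ∈ S, x ≠ q.1) →
      halfPlaneBlaschke s x =
        (1 + (starRingEnd ℂ) C * (1 - ∏ q ∈ S, (x - q.2) / (x - q.1))) /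
          (1 + C * (1 - ∏ q ∈ S, (x - q.2) / (x - q.1))) := by
  classical
  have hC0 : C ≠ 0 := fun h => by simp [h] at hC
  obtain ⟨c, hc0, -, hc⟩ := exists_partial_fractions S hlt hdis
  let A : Polynomial ℂ := ∏ q ∈ S, (Polynomial.X - Polynomial.C (q.1 : ℂ))
  let P : Polynomial ℂ := ∏ q ∈ S, (Polynomial.X - Polynomial.C (q.2 : ℂ))
  have hAm : A.Monic := Polynomial.monic_prod_of_monic _ _ fun q _ => Polynomial.monic_X_sub_C _
  have hPm : P.Monic := Polynomial.monic_prod_of_monic _ _ fun q _ => Polynomial.monic_X_sub_C _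
  have hAd : A.degree = S.card := by simp [A, Polynomial.degree_prod]
  have hPd : P.degree = S.card := by simp [P, Polynomial.degree_prod]
  let D : Polynomial ℂ := A + Polynomial.C C * (A - P)
  have hdeg : (Polynomial.C C * (A - P)).degree < A.degree := by
    rw [Polynomial.degree_C_mul hC0]
    exact Polynomial.degree_sub_lt_left (hAd.trans hPd.symm) hAm.ne_zero
      (by rw [hAm.leadingCoeff, hPm.leadingCoeff])
  have hDm : D.Monic := hAm.add_of_left hdeg
  have hDd : D.degree = S.card := (Polynomial.degree_add_eq_left_of_degree_lt hdeg).trans hAd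
  have hDe : ∀ x, D.eval x = ∏ q ∈ S, (x - q.1) +
      C * (∏ q ∈ S, (x - q.1) - ∏ q ∈ S, (x - q.2)) := by
    intro x
    simp [D, A, P, Polynomial.eval_prod]
  have hprod : ∀ x : ℂ, (∀ q ∈ S, x ≠ q.1) → ∏ q ∈ S, (x - q.1) ≠ 0 := fun x hx =>
    Finset.prod_ne_zero_iff.mpr fun q hq => sub_ne_zero.mpr (hx q hq)
  have hDe' : ∀ x : ℂ, (∀ q ∈ S, x ≠ q.1) → D.eval x = (∏ q ∈ S, (x - q.1)) *
      (1 + C * (1 - ∏ q ∈ S, (x - q.2) / (x - q.1))) := by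
    intro x hx
    have := hprod x hx
    rw [hDe, Finset.prod_div_distrib]
    field_simp
  have hroots : ∀ u ∈ D.roots, u.im < 0 := by
    intro u hu
    have h0 : D.eval u = 0 := (Polynomial.mem_roots'.mp hu).2
    by_contra! hcon
    by_cases hx : ∀ q ∈ S, u ≠ q.1
    · rw [hDe' u hx, hc u hx] at h0
      have h1 := (mul_eq_zero.mp h0).resolve_left (hprod u hx)
      rw [sub_sub_cancel] at h1
      set s := ∑ q ∈ S, (c q : ℂ) / (u - q.1) with hs
      have hsim : s.im ≤ 0 := by
        rw [hs, im_sum]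
        refine Finset.sum_nonpos fun q hq => ?_
        rw [div_im]
        simp only [ofReal_im, ofReal_re, sub_im, sub_zero, zero_mul, zero_div, zero_sub]
        exact neg_nonpos.mpr (div_nonneg (mul_nonneg (hc0 q hq) hcon) (normSq_nonneg _))
      have hre := congrArg re h1
      have him := congrArg im h1
      simp only [add_re, one_re, mul_re, zero_re, add_im, one_im, mul_im, zero_im] at hre him
      have h2 : C.im = (C.re ^ 2 + C.im ^ 2) * s.im := by
        linear_combination C.im * hre - C.re * him
      nlinarith [sq_nonneg C.re, sq_nonneg C.im, mul_nonneg (add_nonneg (sq_nonneg C.re)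
        (sq_nonneg C.im)) (neg_nonneg.mpr hsim)]
    · push Not at hx
      obtain ⟨p, hp, rfl⟩ := hx
      rw [hDe, Finset.prod_eq_zero (f := fun q : ℝ × ℝ => (p.1 : ℂ) - q.1) hp (sub_self _),
        zero_sub, zero_add] at h0
      have h1 := neg_eq_zero.mp ((mul_eq_zero.mp h0).resolve_left hC0)
      obtain ⟨q, hq, h2⟩ := Finset.prod_eq_zero_iff.mp h1
      have h3 : p.1 = q.2 := by exact_mod_cast sub_eq_zero.mp h2
      have hqlt := hlt q hq
      have hne : p ≠ q := fun h => by rw [h] at h3; linarith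
      exact Set.disjoint_left.mp (hdis hp hq hne) (show p.1 ∈ Icc p.1 p.2 from
        ⟨le_rfl, (hlt p hp).le⟩) ⟨h3 ▸ hqlt.le, h3.le⟩
  have hsplit : D.Splits := IsAlgClosed.splits D
  have heval := fun x => hsplit.eval_eq_prod_roots_of_monic hDm x
  refine ⟨D.roots.map (starRingEnd ℂ), ?_, ?_, ?_⟩
  · intro h
    have h1 : D.roots = 0 := by simpa using h
    have h2 : 0 < D.degree := by rw [hDd]; exact_mod_cast hS.card_pos
    obtain ⟨u, hu⟩ := IsAlgClosed.exists_root D h2.ne'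
    have h3 : u ∈ D.roots := (Polynomial.mem_roots hDm.ne_zero).mpr hu
    simp [h1] at h3
  · intro w hw
    obtain ⟨u, hu, rfl⟩ := Multiset.mem_map.mp hw
    simpa using hroots u hu
  · intro x hx
    have hx' : ∀ q ∈ S, (starRingEnd ℂ) x ≠ q.1 := fun q hq h =>
      hx q hq (by simpa using congrArg (starRingEnd ℂ) h)
    have h1 : (starRingEnd ℂ) (D.eval ((starRingEnd ℂ) x)) =
        (D.roots.map fun u => x - (starRingEnd ℂ) u).prod := by
      rw [heval, map_multiset_prod, Multiset.map_map]
      simp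
    rw [halfPlaneBlaschke, Multiset.map_map]
    simp only [Function.comp_apply, conj_conj]
    rw [Multiset.prod_map_div, ← h1, ← heval, hDe' x hx, hDe' _ hx']
    simp only [map_mul, map_prod, map_sub, map_add, map_one, map_div₀, conj_conj, conj_ofReal]
    rw [mul_div_mul_left _ _ (hprod x hx)]

theorem exists_norm_eq_one_conj_eq_mul (ζ : ℂ) (hζ : ‖ζ‖ = 1) (h1 : ζ ≠ 1) :
    ∃ c : ℂ, ‖c‖ = 1 ∧ 0 < c.im ∧ (starRingEnd ℂ) c = ζ * c := by
  obtain ⟨b, hb⟩ := IsAlgClosed.exists_pow_nat_eq ((starRingEnd ℂ) ζ) (n := 2) (by norm_num)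
  have hζn : ζ * (starRingEnd ℂ) ζ = 1 := by
    rw [mul_conj, normSq_eq_norm_sq, hζ]; norm_num
  have hbn : ‖b‖ = 1 := by
    have : ‖b‖ ^ 2 = 1 := by rw [← norm_pow, hb, norm_conj, hζ]
    exact (pow_eq_one_iff_of_nonneg (norm_nonneg _) two_ne_zero).mp this
  have hbb : b * (starRingEnd ℂ) b = 1 := by
    rw [mul_conj, normSq_eq_norm_sq, hbn]; norm_num
  have hconj : (starRingEnd ℂ) b = ζ * b := by
    have h0 : b ≠ 0 := fun h => by simp [h] at hbn
    refine mul_left_cancel₀ h0 ?_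
    rw [hbb, ← hζn, ← hb]
    ring
  have him : b.im ≠ 0 := by
    intro h
    have h2 : (starRingEnd ℂ) b = b := conj_eq_iff_im.mpr h
    have h3 : (starRingEnd ℂ) ζ = 1 := by rw [← hb, sq, ← hbb, h2]
    exact h1 (by simpa using congrArg (starRingEnd ℂ) h3)
  rcases lt_or_gt_of_ne him with h | h
  · exact ⟨-b, by simpa using hbn, by simpa using h, by simp [hconj]⟩
  · exact ⟨b, hbn, h, hconj⟩

/-- Approximating a unimodular constant other than `1` on a compact null set of the real line. -/
theorem exists_halfPlaneBlaschke_near_const_of_ne_one {K : Set ℝ} (hK : IsCompact K)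
    (hK0 : volume K = 0) (hne : K.Nonempty) {F : Set ℂ} (hF : IsCompact F)
    (hKF : ∀ t ∈ K, (t : ℂ) ∉ F) {ζ : ℂ} (hζ : ‖ζ‖ = 1) (hζ1 : ζ ≠ 1) {ε : ℝ} (hε : 0 < ε) :
    ∃ s : Multiset ℂ, s ≠ 0 ∧ (∀ w ∈ s, 0 < w.im) ∧
      (∀ t ∈ K, ‖halfPlaneBlaschke s t - ζ‖ < ε) ∧ ∀ z ∈ F, ‖halfPlaneBlaschke s z - 1‖ < ε := by
  obtain ⟨c, hc1, hcim, hcconj⟩ := exists_norm_eq_one_conj_eq_mul ζ hζ hζ1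
  obtain ⟨d, hd0, hd⟩ : ∃ d : ℝ, 0 < d ∧ ∀ z ∈ F, ∀ t ∈ K, d < ‖z - t‖ := by
    have hKc : IsCompact ((fun t : ℝ => (t : ℂ)) '' K) := hK.image continuous_ofReal
    have hdis : Disjoint F ((fun t : ℝ => (t : ℂ)) '' K) := by
      refine Set.disjoint_left.mpr ?_
      rintro _ hz ⟨t, ht, rfl⟩
      exact hKF t ht hz
    obtain ⟨r, hr0, hr⟩ := exists_pos_forall_lt_edist hF hKc.isClosed hdis
    refine ⟨r, by exact_mod_cast hr0, fun z hz t ht => ?_⟩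
    have := hr z hz t ⟨t, ht, rfl⟩
    rw [edist_nndist, ENNReal.coe_lt_coe] at this
    rw [← dist_eq_norm]
    exact_mod_cast this
  set l : ℝ := 2 + 2 / ε with hl
  have hl1 : 1 < l := by
    have : 0 < 2 / ε := by positivity
    linarith
  have hl0 : 0 < l := by linarith
  set C : ℂ := l * c with hC
  have hCn : ‖C‖ = l := by rw [hC, norm_mul, hc1, mul_one, norm_real, Real.norm_of_nonneg hl0.le]
  have hCim : 0 < C.im := by rw [hC, im_ofReal_mul]; positivity
  have hCconj : (starRingEnd ℂ) C = ζ * C := by rw [hC, map_mul, conj_ofReal, hcconj]; ring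
  have hζ1' : ‖1 - ζ‖ ≤ 2 := (norm_sub_le _ _).trans (by rw [hζ, norm_one]; norm_num)
  set m : ℝ := min (1 / 2) (ε / 8)
  have hm0 : 0 < m := by positivity
  set η : ℝ := min (d / 2) (d / 2 * m / l)
  obtain ⟨S, hlt, hlen, hmeet, hdis, hcov, hsum⟩ :=
    exists_disjoint_interval_cover hK hK0 (η := η) (by positivity)
  have hS : S.Nonempty := by
    obtain ⟨t, ht⟩ := hne
    obtain ⟨q, hq, -⟩ := hcov t ht
    exact ⟨q, hq⟩
  obtain ⟨s, hs0, hsim, hs⟩ := exists_halfPlaneBlaschke_eq S hS hlt hdis hCim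
  obtain ⟨r, hr0, hrs, hr⟩ := exists_partial_fractions S hlt hdis
  refine ⟨s, hs0, hsim, fun t ht => ?_, fun z hz => ?_⟩
  · obtain ⟨q, hq, hqt⟩ := hcov t ht
    have hout : ∀ p ∈ S, p ≠ q → t < p.1 ∨ p.2 < t := by
      intro p hp hpq
      by_contra! hcon
      exact Set.disjoint_left.mp (hdis hp hq hpq) (show t ∈ Icc p.1 p.2 from hcon)
        (Ioo_subset_Icc_self hqt)
    have hne : ∀ p ∈ S, (t : ℂ) ≠ p.1 := by
      intro p hp h
      have h : t = p.1 := by exact_mod_cast h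
      by_cases hpq : p = q
      · rw [hpq] at h; exact hqt.1.ne' h
      · rcases hout p hp hpq with h' | h' <;> linarith [hlt p hp]
    have hQ : ∏ p ∈ S, (t - p.2) / (t - p.1) ≤ 0 := by
      rw [← Finset.mul_prod_erase S _ hq]
      refine mul_nonpos_of_nonpos_of_nonneg
        (div_nonpos_of_nonpos_of_nonneg (by linarith [hqt.2]) (by linarith [hqt.1]))
        (Finset.prod_nonneg fun p hp => ?_)
      have hp' := Finset.mem_of_mem_erase hp
      have := hlt p hp'
      rcases hout p hp' (Finset.ne_of_mem_erase hp) with h | h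
      · exact div_nonneg_of_nonpos (by linarith) (by linarith)
      · exact div_nonneg (by linarith) (by linarith)
    rw [hs t hne, hCconj]
    set v : ℝ := 1 - ∏ p ∈ S, (t - p.2) / (t - p.1) with hv
    have hvc : (1 - ∏ p ∈ S, ((t : ℂ) - p.2) / (t - p.1) : ℂ) = (v : ℂ) := by
      rw [hv]; push_cast; rfl
    rw [hvc]
    have hden : l - 1 ≤ ‖1 + C * v‖ := by
      have h1 : ‖C * v‖ - ‖(1 : ℂ)‖ ≤ ‖1 + C * v‖ := by
        have := norm_sub_norm_le (C * v) (-1)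
        rw [norm_neg, sub_neg_eq_add, add_comm (C * (v : ℂ))] at this
        exact this
      have hv1 : 1 ≤ v := by linarith
      rw [norm_mul, hCn, norm_real, Real.norm_of_nonneg (by linarith), norm_one] at h1
      nlinarith
    have hdp : 0 < ‖1 + C * v‖ := by linarith
    have hd0 : 1 + C * v ≠ 0 := norm_pos_iff.mp hdp
    have heq : (1 + ζ * C * v) / (1 + C * v) - ζ = (1 - ζ) / (1 + C * v) := by
      field_simp
      ring
    rw [heq, norm_div, div_lt_iff₀ hdp]
    have hεl : ε * (l - 1) = ε + 2 := by rw [hl]; field_simp; ring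
    nlinarith
  · have hfar : ∀ q ∈ S, d / 2 ≤ ‖z - q.1‖ := by
      intro q hq
      obtain ⟨t, ht, htq⟩ := hmeet q hq
      have h1 := hd z hz t ht
      have h2 : ‖z - t‖ ≤ ‖z - q.1‖ + ‖(q.1 : ℂ) - t‖ := by
        simpa using norm_add_le (z - q.1) ((q.1 : ℂ) - t)
      have h3 : ‖(q.1 : ℂ) - t‖ < d / 2 := by
        rw [← ofReal_sub, norm_real, Real.norm_eq_abs, abs_lt]
        have := (hlen q hq).trans_le (min_le_left _ _)
        constructor <;> linarith [htq.1, htq.2]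
      linarith
    have hne : ∀ q ∈ S, z ≠ q.1 := by
      intro q hq h
      have := hfar q hq
      rw [h, sub_self, norm_zero] at this
      linarith
    rw [hs z hne, hCconj, hr z hne, sub_sub_cancel]
    set v : ℂ := ∑ q ∈ S, (r q : ℂ) / (z - q.1)
    have hvn : ‖v‖ ≤ m / l := by
      calc ‖v‖ ≤ ∑ q ∈ S, r q / (d / 2) := by
            refine norm_sum_le_of_le _ fun q hq => ?_
            rw [norm_div, norm_real, Real.norm_of_nonneg (hr0 q hq)]
            exact div_le_div_of_nonneg_left (hr0 q hq) (by positivity) (hfar q hq)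
        _ = (∑ q ∈ S, (q.2 - q.1)) / (d / 2) := by rw [← Finset.sum_div, hrs]
        _ ≤ (d / 2 * m / l) / (d / 2) := by
            gcongr
            exact hsum.le.trans (min_le_right _ _)
        _ = m / l := by field_simp
    have hCv : ‖C * v‖ ≤ m := by
      rw [norm_mul, hCn, mul_comm, ← le_div_iff₀ hl0]
      exact hvn
    have hden : 1 / 2 ≤ ‖1 + C * v‖ := by
      have h1 := norm_sub_norm_le (1 : ℂ) (-(C * v))
      rw [norm_neg, sub_neg_eq_add, norm_one] at h1
      linarith [min_le_left (1 / 2) (ε / 8)]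
    have hdp : 0 < ‖1 + C * v‖ := by linarith
    have hd0 : 1 + C * v ≠ 0 := norm_pos_iff.mp hdp
    have heq : (1 + ζ * C * v) / (1 + C * v) - 1 = -((1 - ζ) * (C * v)) / (1 + C * v) := by
      field_simp
      ring
    rw [heq, norm_div, div_lt_iff₀ hdp, norm_neg, norm_mul]
    have h1 : ‖C * v‖ ≤ ε / 8 := hCv.trans (min_le_right _ _)
    nlinarith [norm_nonneg (C * v), norm_nonneg (1 - ζ)]

theorem exists_halfPlaneBlaschke_near_const {K : Set ℝ} (hK : IsCompact K)
    (hK0 : volume K = 0) (hne : K.Nonempty) {F : Set ℂ} (hF : IsCompact F)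
    (hKF : ∀ t ∈ K, (t : ℂ) ∉ F) {ζ : ℂ} (hζ : ‖ζ‖ = 1) {ε : ℝ} (hε : 0 < ε) :
    ∃ s : Multiset ℂ, s ≠ 0 ∧ (∀ w ∈ s, 0 < w.im) ∧
      (∀ t ∈ K, ‖halfPlaneBlaschke s t - ζ‖ < ε) ∧ ∀ z ∈ F, ‖halfPlaneBlaschke s z - 1‖ < ε := by
  by_cases hζ1 : ζ = 1
  · subst hζ1
    set δ : ℝ := min 1 (ε / 4)
    have hsq : ∀ a b : ℂ, ‖b‖ = 1 → b * b = 1 → ‖a - b‖ < δ → ‖a * a - 1‖ < ε := by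
      intro a b hb hbb hab
      have h1 : a * a - 1 = (a - b) * ((a - b) + 2 * b) := by linear_combination hbb
      have h2 : ‖a - b + 2 * b‖ ≤ ‖a - b‖ + 2 := by
        simpa [hb] using norm_add_le (a - b) (2 * b)
      rw [h1, norm_mul]
      have h3 := hab.trans_le (min_le_left _ _)
      have h4 := hab.trans_le (min_le_right _ _)
      nlinarith [norm_nonneg (a - b)]
    obtain ⟨s, hs0, hsim, hsK, hsF⟩ := exists_halfPlaneBlaschke_near_const_of_ne_one hK hK0 hne hF
      hKF (ζ := -1) (by simp) (by norm_num) (ε := δ) (by positivity)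
    refine ⟨s + s, by simpa using hs0, by simpa using hsim, fun t ht => ?_, fun z hz => ?_⟩
    · rw [halfPlaneBlaschke_add]
      exact hsq _ (-1) (by simp) (by norm_num) (hsK t ht)
    · rw [halfPlaneBlaschke_add]
      exact hsq _ 1 (by simp) (by norm_num) (hsF z hz)
  · exact exists_halfPlaneBlaschke_near_const_of_ne_one hK hK0 hne hF hKF hζ hζ1 hε

theorem exists_halfPlaneBlaschke_approx_of_nonempty {K : Set ℝ} (hK : IsCompact K)
    (hK0 : volume K = 0) (hne : K.Nonempty) {L : Set ℂ} (hL : IsCompact L)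
    (hLim : ∀ z ∈ L, 0 < z.im) {φ : ℝ → ℂ} (hφ : ContinuousOn φ K) (hφ1 : ∀ t ∈ K, ‖φ t‖ = 1)
    {ε : ℝ} (hε : 0 < ε) :
    ∃ s : Multiset ℂ, s ≠ 0 ∧ (∀ w ∈ s, 0 < w.im) ∧
      (∀ t ∈ K, ‖halfPlaneBlaschke s t - φ t‖ < ε) ∧ ∀ z ∈ L, ‖halfPlaneBlaschke s z - 1‖ < ε := by
  classical
  obtain ⟨η, hη0, hη⟩ := uniformContinuousOn_iff.mp (hK.uniformContinuousOn_of_continuous hφ)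
    (ε / 2) (by positivity)
  obtain ⟨S, hlt, hlen, hmeet, hdis, hcov, -⟩ := exists_disjoint_interval_cover hK hK0 hη0
  have hS : S.Nonempty := by
    obtain ⟨t, ht⟩ := hne
    obtain ⟨q, hq, -⟩ := hcov t ht
    exact ⟨q, hq⟩
  let J : ℝ × ℝ → Set ℝ := fun q => K ∩ Icc q.1 q.2
  have hJ : ∀ q, IsCompact (J q) := fun q => hK.inter_right isClosed_Icc
  let F : ℝ × ℝ → Set ℂ := fun q => L ∪ ⋃ p ∈ S.erase q, (fun t : ℝ => (t : ℂ)) '' J p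
  have hF : ∀ q, IsCompact (F q) := fun q =>
    hL.union ((S.erase q).isCompact_biUnion fun p _ => (hJ p).image continuous_ofReal)
  have hJF : ∀ q ∈ S, ∀ t ∈ J q, (t : ℂ) ∉ F q := by
    rintro q hq t ht (h | h)
    · simpa using hLim _ h
    · simp only [mem_iUnion] at h
      obtain ⟨p, hp, u, hu, hut⟩ := h
      obtain rfl : u = t := ofReal_injective hut
      exact Set.disjoint_left.mp (hdis (Finset.mem_of_mem_erase hp) hq (Finset.ne_of_mem_erase hp))
        hu.2 ht.2
  choose! τ hτK hτ using hmeet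
  have hcard : (0 : ℝ) < S.card := by exact_mod_cast hS.card_pos
  have hpiece : ∀ q ∈ S, ∃ s : Multiset ℂ, s ≠ 0 ∧ (∀ w ∈ s, 0 < w.im) ∧
      (∀ t ∈ J q, ‖halfPlaneBlaschke s t - φ (τ q)‖ < ε / 2 / S.card) ∧
      ∀ z ∈ F q, ‖halfPlaneBlaschke s z - 1‖ < ε / 2 / S.card := fun q hq =>
    exists_halfPlaneBlaschke_near_const (hJ q)
      (measure_mono_null inter_subset_left hK0)
      ⟨τ q, hτK q hq, Ioo_subset_Icc_self (hτ q hq)⟩ (hF q) (hJF q hq) (hφ1 _ (hτK q hq))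
      (by positivity)
  choose! s hs0 hsim hsJ hsF using hpiece
  have hprod : ∀ (x : ℂ) (g : ℝ × ℝ → ℂ), 0 ≤ x.im → (∀ q ∈ S, ‖g q‖ ≤ 1) →
      (∀ q ∈ S, ‖halfPlaneBlaschke (s q) x - g q‖ ≤ ε / 2 / S.card) →
      ‖halfPlaneBlaschke (∑ q ∈ S, s q) x - ∏ q ∈ S, g q‖ ≤ ε / 2 := by
    intro x g hx hg h
    rw [halfPlaneBlaschke_sum]
    refine (norm_prod_sub_prod_le_sum S _ _
      (fun q hq => norm_halfPlaneBlaschke_le_one (hsim q hq) hx) hg).trans ?_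
    refine (Finset.sum_le_card_nsmul S _ _ h).trans_eq ?_
    rw [nsmul_eq_mul]
    field_simp
  refine ⟨∑ q ∈ S, s q, ?_, ?_, fun t ht => ?_, fun z hz => ?_⟩
  · intro h
    obtain ⟨q, hq⟩ := hS
    exact hs0 q hq (Finset.sum_eq_zero_iff.mp h q hq)
  · intro w hw
    obtain ⟨q, hq, hwq⟩ := Multiset.mem_sum.mp hw
    exact hsim q hq w hwq
  · obtain ⟨q, hq, hqt⟩ := hcov t ht
    have hqJ : t ∈ J q := ⟨ht, Ioo_subset_Icc_self hqt⟩
    have h1 := hprod t (fun p => if p = q then φ (τ q) else 1) (by simp)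
      (fun p _ => by
        split_ifs
        · exact (hφ1 _ (hτK q hq)).le
        · simp)
      (fun p hp => by
        split_ifs with hpq
        · rw [hpq]; exact (hsJ q hq t hqJ).le
        · refine (hsF p hp t (Or.inr ?_)).le
          simp only [mem_iUnion]
          exact ⟨q, Finset.mem_erase.mpr ⟨fun h => hpq h.symm, hq⟩, t, hqJ, rfl⟩)
    rw [Finset.prod_ite_eq' S q, if_pos hq] at h1
    have h2 : ‖φ (τ q) - φ t‖ < ε / 2 := by
      rw [← dist_eq_norm]
      refine hη _ (hτK q hq) _ ht ?_
      rw [Real.dist_eq, abs_lt]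
      have h3 := hτ q hq
      have h4 := hlen q hq
      constructor <;> linarith [h3.1, h3.2, hqt.1, hqt.2]
    calc _ ≤ _ := norm_sub_le_norm_sub_add_norm_sub _ (φ (τ q)) _
      _ < ε := by linarith
  · have h1 := hprod z (fun _ => 1) (hLim z hz).le (by simp)
      fun q hq => (hsF q hq z (Or.inl hz)).le
    rw [Finset.prod_const_one] at h1
    linarith

/-- The simultaneous approximation theorem for the upper half-plane. -/
theorem exists_halfPlaneBlaschke_approx {K : Set ℝ} (hK : IsCompact K)
    (hK0 : volume K = 0) {L : Set ℂ} (hL : IsCompact L)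
    (hLim : ∀ z ∈ L, 0 < z.im) {φ : ℝ → ℂ} (hφ : ContinuousOn φ K) (hφ1 : ∀ t ∈ K, ‖φ t‖ = 1)
    {ε : ℝ} (hε : 0 < ε) :
    ∃ s : Multiset ℂ, s ≠ 0 ∧ (∀ w ∈ s, 0 < w.im) ∧
      (∀ t ∈ K, ‖halfPlaneBlaschke s t - φ t‖ < ε) ∧ ∀ z ∈ L, ‖halfPlaneBlaschke s z - 1‖ < ε := by
  rcases K.eq_empty_or_nonempty with rfl | hne
  · obtain ⟨s, hs0, hsim, -, hs⟩ := exists_halfPlaneBlaschke_approx_of_nonempty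
      (isCompact_singleton (x := (0 : ℝ))) (by simp) (by simp) hL hLim
      (φ := fun _ => 1) continuousOn_const (by simp) hε
    exact ⟨s, hs0, hsim, by simp, hs⟩
  · exact exists_halfPlaneBlaschke_approx_of_nonempty hK hK0 hne hL hLim hφ hφ1 hε

theorem isFiniteBlaschke_of_multiset {s : Multiset ℂ} (hs0 : s ≠ 0) (hs : ∀ v ∈ s, ‖v‖ < 1)
    {ζ : ℂ} (hζ : ‖ζ‖ = 1) :
    IsFiniteBlaschke fun z =>
      ζ * (s.map fun v => (z - v) / (1 - (starRingEnd ℂ) v * z)).prod := by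
  obtain ⟨l, rfl⟩ := Quot.exists_rep s
  cases l with
  | nil => exact absurd rfl hs0
  | cons a l =>
    refine ⟨l.length, ζ, (a :: l).get, hζ, fun k => hs _ (List.get_mem (a :: l) k), fun z => ?_⟩
    change ζ * ((a :: l).map fun v => (z - v) / (1 - (starRingEnd ℂ) v * z)).prod = _
    conv_lhs => rw [← List.ofFn_get (a :: l), List.map_ofFn, List.prod_ofFn]
    rfl

/-- The Cayley transform taking the unit disc to the upper half-plane and `p` to infinity. -/
def cayley (p z : ℂ) : ℂ := I * (p + z) / (p - z)

theorem cayley_im {p z : ℂ} (hp : ‖p‖ = 1) :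
    (cayley p z).im = (1 - ‖z‖ ^ 2) / normSq (p - z) := by
  have h : p.re * p.re + p.im * p.im = 1 := by
    rw [← normSq_apply, normSq_eq_norm_sq, hp, one_pow]
  rw [cayley, div_im, ← sub_div, ← normSq_eq_norm_sq, normSq_apply z]
  congr 1
  simp only [mul_re, mul_im, I_re, I_im, add_re, add_im, sub_re, sub_im]
  linear_combination h

theorem exists_isFiniteBlaschke_eq_comp_cayley {p : ℂ} (hp : ‖p‖ = 1) {s : Multiset ℂ}
    (hs0 : s ≠ 0) (hs : ∀ w ∈ s, 0 < w.im) :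
    ∃ B, IsFiniteBlaschke B ∧ ∀ z, z ≠ p → B z = halfPlaneBlaschke s (cayley p z) := by
  have hp0 : p ≠ 0 := fun h => by simp [h] at hp
  have hpp : p * (starRingEnd ℂ) p = 1 := by
    rw [mul_conj, normSq_eq_norm_sq, hp]; norm_num
  let v : ℂ → ℂ := fun w => (w - I) * p / (w + I)
  let ξ : ℂ → ℂ := fun w => -(w + I) / (p * ((starRingEnd ℂ) w - I))
  have hne : ∀ w : ℂ, 0 < w.im → w + I ≠ 0 := fun w hw h => by
    have := congrArg im h
    simp at this
    linarith
  have hne' : ∀ w : ℂ, 0 < w.im → (starRingEnd ℂ) w - I ≠ 0 := fun w hw h =>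
    hne w hw (by simpa using congrArg (starRingEnd ℂ) h)
  have hv : ∀ w ∈ s, ‖v w‖ < 1 := by
    intro w hw
    have h0 := hs w hw
    rw [norm_div, norm_mul, hp, mul_one, div_lt_one (norm_pos_iff.mpr (hne w h0)),
      ← sq_lt_sq₀ (norm_nonneg _) (norm_nonneg _), ← normSq_eq_norm_sq, ← normSq_eq_norm_sq,
      normSq_apply, normSq_apply]
    simp only [sub_re, sub_im, add_re, add_im, I_re, I_im]
    nlinarith
  have hξ : ∀ w ∈ s, ‖ξ w‖ = 1 := by
    intro w hw
    have h1 : ‖(starRingEnd ℂ) w - I‖ = ‖w + I‖ := by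
      rw [← norm_conj (w + I), map_add, conj_I, sub_eq_add_neg]
    rw [norm_div, norm_neg, norm_mul, hp, one_mul, h1]
    exact div_self (norm_ne_zero_iff.mpr (hne w (hs w hw)))
  have hfactor : ∀ w ∈ s, ∀ z, z ≠ p → (cayley p z - w) / (cayley p z - (starRingEnd ℂ) w) =
      ξ w * ((z - v w) / (1 - (starRingEnd ℂ) (v w) * z)) := by
    intro w hw z hz
    have h1 := hne w (hs w hw)
    have h2 := hne' w (hs w hw)
    have h3 : p - z ≠ 0 := sub_ne_zero.mpr hz.symm
    have e1 : cayley p z - w = ((I + w) * z + (I - w) * p) / (p - z) := by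
      rw [cayley]; field_simp; ring
    have e2 : cayley p z - (starRingEnd ℂ) w =
        ((I + (starRingEnd ℂ) w) * z + (I - (starRingEnd ℂ) w) * p) / (p - z) := by
      rw [cayley]; field_simp; ring
    have e3 : z - v w = ((I + w) * z + (I - w) * p) / (w + I) := by
      simp only [v]; field_simp; ring
    have e4 : 1 - (starRingEnd ℂ) (v w) * z =
        -((I + (starRingEnd ℂ) w) * z + (I - (starRingEnd ℂ) w) * p) /
          (p * ((starRingEnd ℂ) w - I)) := by
      have : (starRingEnd ℂ) p = p⁻¹ := eq_inv_of_mul_eq_one_right hpp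
      simp only [v, map_div₀, map_mul, map_sub, map_add, conj_I, this]
      rw [← sub_eq_add_neg]
      field_simp
      ring
    rw [e1, e2, e3, e4, div_div_div_cancel_right₀ h3]
    simp only [ξ]
    by_cases h0 : (I + (starRingEnd ℂ) w) * z + (I - (starRingEnd ℂ) w) * p = 0
    · simp [h0]
    · have h4 : p * ((starRingEnd ℂ) w - I) ≠ 0 := mul_ne_zero hp0 h2
      field_simp
  refine ⟨_, isFiniteBlaschke_of_multiset (s := s.map v) (ζ := (s.map ξ).prod) (by simpa using hs0)
    (by simpa using hv) ?_, fun z hz => ?_⟩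
  · change normHom (s.map ξ).prod = 1
    rw [map_multiset_prod, Multiset.map_map]
    refine Multiset.prod_eq_one fun r hr => ?_
    obtain ⟨w, hw, rfl⟩ := Multiset.mem_map.mp hr
    exact hξ w hw
  · rw [Multiset.map_map, ← Multiset.prod_map_mul, halfPlaneBlaschke]
    exact congrArg _ (Multiset.map_congr rfl fun w hw => (hfactor w hw z hz).symm)

/-- The key special case `f ≡ 1` of the simultaneous approximation theorem. -/
theorem simultaneous_approx_one (K : Set ℂ) (hKc : IsCompact K)
    (hKs : K ⊆ Metric.sphere (0:ℂ) 1) (hK0 : arclength K = 0)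
    (L : Set ℂ) (hLc : IsCompact L) (hLD : L ⊆ Metric.ball (0:ℂ) 1)
    (φ : ℂ → ℂ) (hφc : ContinuousOn φ K) (hφ1 : ∀ z ∈ K, ‖φ z‖ = 1)
    (ε : ℝ) (hε : 0 < ε) :
    ∃ B : ℂ → ℂ, IsFiniteBlaschke B ∧
      (∀ z ∈ K, ‖B z - φ z‖ < ε) ∧ (∀ z ∈ L, ‖B z - 1‖ < ε) := by
  let Θ : Set ℝ := circleMap 0 1 ⁻¹' K ∩ Ioc 0 (2 * Real.pi)
  have hΘ : volume Θ = 0 := by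
    have hm : Measurable (circleMap 0 1) := (continuous_circleMap 0 1).measurable
    rw [arclength, Measure.map_apply hm hKc.measurableSet,
      Measure.restrict_apply (hm hKc.measurableSet)] at hK0
    exact hK0
  obtain ⟨p, hp, hpK⟩ : ∃ p : ℂ, ‖p‖ = 1 ∧ p ∉ K := by
    by_contra! hcon
    have h1 : Ioc 0 (2 * Real.pi) ⊆ Θ := fun θ hθ => ⟨hcon _ (by simp), hθ⟩
    have h2 := measure_mono_null h1 hΘ
    rw [Real.volume_Ioc, ENNReal.ofReal_eq_zero] at h2
    linarith [Real.pi_pos]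
  have hKp : ∀ z ∈ K, z ≠ p := fun z hz h => hpK (h ▸ hz)
  have hLp : ∀ z ∈ L, z ≠ p := fun z hz h => by
    have := mem_ball_zero_iff.mp (hLD hz)
    rw [h, hp] at this
    exact lt_irrefl _ this
  have hcont : ∀ z, z ≠ p → ContinuousAt (cayley p) z := fun z hz =>
    ContinuousAt.div (by fun_prop) (by fun_prop) (sub_ne_zero.mpr hz.symm)
  have hKreal : ∀ z ∈ K, cayley p z = ((cayley p z).re : ℂ) := by
    intro z hz
    refine Complex.ext rfl ?_
    rw [cayley_im hp, mem_sphere_zero_iff_norm.mp (hKs hz)]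
    simp
  let K' : Set ℝ := (fun z => (cayley p z).re) '' K
  have hK' : IsCompact K' := hKc.image_of_continuousOn
    (continuous_re.comp_continuousOn fun z hz => (hcont z (hKp z hz)).continuousWithinAt)
  have hK'0 : volume K' = 0 := by
    have hsub : K' ⊆ (fun θ : ℝ => (cayley p (circleMap 0 1 θ)).re) '' Θ := by
      rintro _ ⟨z, hz, rfl⟩
      have hz1 : z ∈ circleMap 0 1 '' Ioc 0 (2 * Real.pi) := by
        rw [image_circleMap_Ioc, abs_one]
        exact hKs hz
      obtain ⟨θ, hθ, rfl⟩ := hz1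
      exact ⟨θ, ⟨hz, hθ⟩, rfl⟩
    refine measure_mono_null hsub
      (addHaar_image_eq_zero_of_differentiableOn_of_addHaar_eq_zero volume ?_ hΘ)
    intro θ hθ
    have h0 : p - circleMap 0 1 θ ≠ 0 := sub_ne_zero.mpr (hKp _ hθ.1).symm
    have h1 : DifferentiableAt ℝ (circleMap 0 1) θ := differentiable_circleMap 0 1 θ
    have h2 : DifferentiableAt ℝ (fun θ => cayley p (circleMap 0 1 θ)) θ :=
      (((h1.const_add p).const_mul I).div (h1.const_sub p) h0)
    exact (reCLM.differentiableAt.comp θ h2).differentiableWithinAt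
  let Y : ℝ → ℂ := fun t => p * (t - I) / (t + I)
  have htI : ∀ t : ℝ, (t : ℂ) + I ≠ 0 := fun t h => by simpa using congrArg im h
  have hY : Continuous Y := by
    refine Continuous.div (by fun_prop) (by fun_prop) htI
  have hYc : ∀ z ∈ K, Y (cayley p z).re = z := by
    intro z hz
    have h0 := htI (cayley p z).re
    rw [← hKreal z hz] at h0
    simp only [Y]
    rw [← hKreal z hz, div_eq_iff h0, cayley]
    have h1 : p - z ≠ 0 := sub_ne_zero.mpr (hKp z hz).symm
    field_simp
    ring
  have hYK : MapsTo Y K' K := by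
    rintro _ ⟨z, hz, rfl⟩
    simpa only [hYc z hz] using hz
  obtain ⟨s, hs0, hsim, hsK, hsL⟩ := exists_halfPlaneBlaschke_approx hK' hK'0
    (L := cayley p '' L)
    (hLc.image_of_continuousOn fun z hz => (hcont z (hLp z hz)).continuousWithinAt)
    (by
      rintro _ ⟨z, hz, rfl⟩
      rw [cayley_im hp]
      have := mem_ball_zero_iff.mp (hLD hz)
      exact div_pos (by nlinarith [norm_nonneg z])
        (normSq_pos.mpr (sub_ne_zero.mpr (hLp z hz).symm)))
    (φ := φ ∘ Y) (hφc.comp hY.continuousOn hYK) (fun t ht => hφ1 _ (hYK ht)) hε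
  obtain ⟨B, hB, hBs⟩ := exists_isFiniteBlaschke_eq_comp_cayley hp hs0 hsim
  refine ⟨B, hB, fun z hz => ?_, fun z hz => ?_⟩
  · have := hsK _ ⟨z, hz, rfl⟩
    rw [Function.comp_apply, hYc z hz] at this
    rw [hBs z (hKp z hz), hKreal z hz]
    exact this
  · rw [hBs z (hLp z hz)]
    exact hsL _ ⟨z, hz, rfl⟩
end
end

section
/- Let K be a compact subset of the unit circle of arclength measure 0, φ : K → ℂ continuous with sup_K |φ| ≤ 1, U an open subset of ℂ containing K, and f in the disc algebra with sup |f| ≤ 1 on the closed disc and |f| ≡ 1 on K. Then for every ε > 0 there exists g in the disc algebra with sup |g| ≤ 1 such that sup_{z∈K} |g(z) − φ(z)| < ε and |g(z) − f(z)| < ε for all z in the closed disc outside U. -/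
open Complex Metric MeasureTheory Filter Set

noncomputable section

theorem arclength_apply {K : Set ℂ} (hK : MeasurableSet K) :
    arclength K = volume (circleMap 0 1 ⁻¹' K ∩ Set.Ioc 0 (2 * Real.pi)) := by
  have hc : Measurable (circleMap 0 1) := (continuous_circleMap 0 1).measurable
  rw [arclength, Measure.map_apply hc hK, Measure.restrict_apply (hc hK)]

/-- An arclength-null compact subset of the circle has finite covers by discs centred on it,
with arbitrarily small total radius. -/
theorem exists_finset_cover_sum_le {K : Set ℂ} (hKc : IsCompact K)
    (hKs : K ⊆ Metric.sphere (0:ℂ) 1) (hK0 : arclength K = 0) {η : ℝ} (hη : 0 < η) :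
    ∃ (s : Finset ℝ) (r : ℝ → ℝ), (∀ x ∈ s, circleMap 0 1 x ∈ K) ∧ (∀ x ∈ s, 0 < r x) ∧
      ∑ x ∈ s, r x ≤ η ∧ ∀ z ∈ K, ∃ x ∈ s, ‖z - circleMap 0 1 x‖ < r x := by
  have hnull : volume (circleMap 0 1 ⁻¹' K ∩ Set.Ioc 0 (2 * Real.pi)) = 0 := by
    rwa [← arclength_apply hKc.measurableSet]
  obtain ⟨t, r, -, hts, hr, hcov, hsum⟩ := Besicovitch.exists_closedBall_covering_tsum_measure_le
    volume (ε := ENNReal.ofReal η) (by simpa using hη) (fun _ => Set.Ioi (0:ℝ))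
    (circleMap 0 1 ⁻¹' K ∩ Set.Ioc 0 (2 * Real.pi))
    (fun x _ δ hδ => ⟨δ / 2, by simp [hδ], by constructor <;> linarith⟩)
  rw [hnull, zero_add] at hsum
  obtain ⟨b, hbt, hbf, hbK⟩ := hKc.elim_finite_subcover_image (b := t)
    (c := fun x => Metric.ball (circleMap 0 1 x) (2 * r x)) (fun _ _ => Metric.isOpen_ball) (by
      intro z hz
      obtain ⟨θ, hθ, rfl⟩ : ∃ θ ∈ Set.Ioc 0 (2 * Real.pi), circleMap 0 1 θ = z := by
        have := hKs hz
        rw [← abs_one, ← image_circleMap_Ioc] at this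
        exact this
      obtain ⟨x, hx, hθx⟩ := Set.mem_iUnion₂.1 (hcov ⟨hz, hθ⟩)
      refine Set.mem_iUnion₂.2 ⟨x, hx, ?_⟩
      have h1 := (lipschitzWith_circleMap 0 1).dist_le_mul θ x
      have h2 : 0 < r x := hr x hx
      rw [Metric.mem_closedBall] at hθx
      rw [Metric.mem_ball]
      simp at h1
      linarith)
  refine ⟨hbf.toFinset, fun x => 2 * r x, fun x hx => (hts (hbt (hbf.mem_toFinset.1 hx))).1,
    fun x hx => ?_, ?_, fun z hz => ?_⟩
  · have : 0 < r x := hr x (hbt (hbf.mem_toFinset.1 hx))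
    positivity
  · rw [← ENNReal.ofReal_le_ofReal_iff hη.le, ENNReal.ofReal_sum_of_nonneg]
    · refine le_trans ?_ hsum
      simp only [Real.volume_closedBall]
      rw [tsum_subtype t (fun x => ENNReal.ofReal (2 * r x))]
      refine le_trans (Finset.sum_le_sum fun x hx => ?_) (ENNReal.sum_le_tsum hbf.toFinset)
      rw [Set.indicator_of_mem (hbt (hbf.mem_toFinset.1 hx))]
    · intro x hx
      have : 0 < r x := hr x (hbt (hbf.mem_toFinset.1 hx))
      positivity
  · obtain ⟨x, hx, hzx⟩ := Set.mem_iUnion₂.1 (hbK hz)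
    exact ⟨x, hbf.mem_toFinset.2 hx, by rwa [Metric.mem_ball, dist_eq_norm] at hzx⟩

/-- A function holomorphic on the closed disc with nonnegative real part, which is large on a
compact null subset of the circle and small away from it. -/
theorem exists_re_nonneg_large_on {K U : Set ℂ} (hKc : IsCompact K)
    (hKs : K ⊆ Metric.sphere (0:ℂ) 1) (hK0 : arclength K = 0) (hU : IsOpen U) (hKU : K ⊆ U)
    {M δ : ℝ} (hM : 0 < M) (hδ : 0 < δ) :
    ∃ F : ℂ → ℂ, ∀ z ∈ Metric.closedBall (0:ℂ) 1,
      DifferentiableAt ℂ F z ∧ 0 ≤ (F z).re ∧ (z ∈ K → M ≤ (F z).re) ∧ (z ∉ U → ‖F z‖ ≤ δ) := by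
  obtain ⟨d, hd, hdU⟩ := hKc.exists_thickening_subset_open hU hKU
  obtain ⟨s, r, hs, hr, hsum, hcov⟩ := exists_finset_cover_sum_le hKc hKs hK0
    (η := min (d / 2) (δ * d / (8 * M))) (by positivity)
  have hunit : ∀ x, ‖circleMap 0 1 x‖ = 1 := by simp
  let w : ℝ → ℂ → ℂ := fun x z => 1 + r x - z * (starRingEnd ℂ) (circleMap 0 1 x)
  have hwre : ∀ x, ∀ z ∈ Metric.closedBall (0:ℂ) 1, r x ≤ (w x z).re := by
    intro x z hz
    have h1 : (z * (starRingEnd ℂ) (circleMap 0 1 x)).re ≤ 1 := by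
      refine (Complex.re_le_norm _).trans ?_
      rw [norm_mul, RCLike.norm_conj, hunit, mul_one]
      simpa using hz
    simp only [w, Complex.sub_re, Complex.add_re, Complex.one_re, Complex.ofReal_re]
    linarith
  have hweq : ∀ x z, ‖w x z - r x‖ = ‖z - circleMap 0 1 x‖ := by
    intro x z
    have h1 : circleMap 0 1 x * (starRingEnd ℂ) (circleMap 0 1 x) = 1 := by
      rw [Complex.mul_conj, Complex.normSq_eq_norm_sq, hunit]; simp
    have h2 : w x z - r x = -((z - circleMap 0 1 x) * (starRingEnd ℂ) (circleMap 0 1 x)) := by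
      simp only [w]; linear_combination -h1
    rw [h2, norm_neg, norm_mul, RCLike.norm_conj, hunit, mul_one]
  have hrle : ∀ x ∈ s, r x ≤ d / 2 := fun x hx =>
    ((Finset.single_le_sum (fun y hy => (hr y hy).le) hx).trans hsum).trans (min_le_left _ _)
  have hwne : ∀ x ∈ s, ∀ z ∈ Metric.closedBall (0:ℂ) 1, w x z ≠ 0 := by
    intro x hx z hz h
    have := hwre x z hz
    rw [h] at this
    exact absurd (hr x hx) (not_lt.2 (by simpa using this))
  have hre : ∀ x z, (((4 * M * r x : ℝ) : ℂ) / w x z).re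
      = 4 * M * r x * (w x z).re / ‖w x z‖ ^ 2 := by
    intro x z
    rw [div_eq_mul_inv, Complex.re_ofReal_mul, Complex.inv_re, Complex.normSq_eq_norm_sq]
    ring
  have hterm : ∀ x ∈ s, ∀ z ∈ Metric.closedBall (0:ℂ) 1,
      0 ≤ (((4 * M * r x : ℝ) : ℂ) / w x z).re := by
    intro x hx z hz
    rw [hre]
    have := hr x hx
    have := this.le.trans (hwre x z hz)
    positivity
  refine ⟨fun z => ∑ x ∈ s, ((4 * M * r x : ℝ) : ℂ) / w x z, fun z hz => ⟨?_, ?_, ?_, ?_⟩⟩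
  · refine DifferentiableAt.fun_sum fun x hx => ?_
    refine DifferentiableAt.div (by fun_prop) (by simp only [w]; fun_prop) (hwne x hx z hz)
  · rw [Complex.re_sum]
    exact Finset.sum_nonneg fun x hx => hterm x hx z hz
  · intro hzK
    obtain ⟨x, hx, hzx⟩ := hcov z hzK
    rw [Complex.re_sum]
    refine le_trans ?_ (Finset.single_le_sum (fun y hy => hterm y hy z hz) hx)
    have hrx := hr x hx
    have hn : ‖w x z‖ ≤ 2 * r x := by
      have h := norm_add_le (w x z - r x) (r x)
      rw [sub_add_cancel, hweq, Complex.norm_real, Real.norm_of_nonneg hrx.le] at h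
      linarith
    have hpos : 0 < ‖w x z‖ := norm_pos_iff.2 (hwne x hx z hz)
    rw [hre, le_div_iff₀ (by positivity)]
    calc M * ‖w x z‖ ^ 2 ≤ M * (2 * r x) ^ 2 := by gcongr
      _ = 4 * M * r x * r x := by ring
      _ ≤ _ := by gcongr; exact hwre x z hz
  · intro hzU
    have hbound : ∀ x ∈ s, ‖((4 * M * r x : ℝ) : ℂ) / w x z‖ ≤ r x * (8 * M / d) := by
      intro x hx
      have hrx := hr x hx
      have hfar : d ≤ ‖z - circleMap 0 1 x‖ := by
        by_contra! h
        exact hzU (hdU (Metric.mem_thickening_iff.2 ⟨_, hs x hx, by rwa [dist_eq_norm]⟩))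
      have hn : d / 2 ≤ ‖w x z‖ := by
        have h := norm_sub_le (w x z) (r x)
        rw [hweq, Complex.norm_real, Real.norm_of_nonneg hrx.le] at h
        linarith [hrle x hx]
      rw [norm_div, Complex.norm_real, Real.norm_of_nonneg (by positivity)]
      calc 4 * M * r x / ‖w x z‖ ≤ 4 * M * r x / (d / 2) := by gcongr
        _ = _ := by field_simp; ring
    calc _ ≤ ∑ x ∈ s, r x * (8 * M / d) := norm_sum_le_of_le _ hbound
      _ = (∑ x ∈ s, r x) * (8 * M / d) := by rw [Finset.sum_mul]
      _ ≤ δ * d / (8 * M) * (8 * M / d) := by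
        gcongr; exact hsum.trans (min_le_right _ _)
      _ = δ := by field_simp

/-- A function in the unit ball of the disc algebra, close to the constant `c` on a compact null
subset of the circle and close to `1` away from it. -/
theorem exists_approx_const {K U : Set ℂ} (hKc : IsCompact K)
    (hKs : K ⊆ Metric.sphere (0:ℂ) 1) (hK0 : arclength K = 0) (hU : IsOpen U) (hKU : K ⊆ U)
    {c : ℂ} (hc : ‖c‖ < 1) {δ : ℝ} (hδ : 0 < δ) :
    ∃ p : ℂ → ℂ, ∀ z ∈ Metric.closedBall (0:ℂ) 1, DifferentiableAt ℂ p z ∧ ‖p z‖ ≤ 1 ∧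
      (z ∈ K → ‖p z - c‖ ≤ δ) ∧ (z ∉ U → ‖p z - 1‖ ≤ δ) := by
  have hcpos : 0 < 1 - ‖c‖ := by linarith
  obtain ⟨F, hF⟩ := exists_re_nonneg_large_on hKc hKs hK0 hU hKU (M := 4 / δ)
    (δ := δ * (1 - ‖c‖) / 2) (by positivity) (by positivity)
  have hc2 : ‖1 - c‖ ≤ 2 := by
    have := norm_sub_le (1:ℂ) c
    rw [norm_one] at this
    linarith
  have hcre : 1 - ‖c‖ ≤ (1 - c).re := by
    rw [Complex.sub_re, Complex.one_re]
    linarith [Complex.re_le_norm c]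
  refine ⟨fun z => (1 - c + c * F z) / (1 - c + F z), fun z hz => ?_⟩
  obtain ⟨hd, hre, hK, hfar⟩ := hF z hz
  have hden : (1 - c).re + (F z).re ≤ ‖1 - c + F z‖ := by
    simpa using Complex.re_le_norm (1 - c + F z)
  have hpos : 0 < ‖1 - c + F z‖ := by linarith
  have hne : 1 - c + F z ≠ 0 := norm_pos_iff.1 hpos
  refine ⟨?_, ?_, fun hzK => ?_, fun hzU => ?_⟩
  · exact DifferentiableAt.div (by fun_prop) (by fun_prop) hne
  · rw [norm_div, div_le_one hpos]
    refine le_of_sq_le_sq ?_ hpos.le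
    have hcc : c.re * c.re + c.im * c.im ≤ 1 := by
      rw [← Complex.normSq_apply, Complex.normSq_eq_norm_sq]
      nlinarith [norm_nonneg c]
    rw [← Complex.normSq_eq_norm_sq, ← Complex.normSq_eq_norm_sq, Complex.normSq_apply,
      Complex.normSq_apply]
    simp only [Complex.add_re, Complex.sub_re, Complex.one_re, Complex.mul_re, Complex.add_im,
      Complex.sub_im, Complex.one_im, Complex.mul_im]
    nlinarith [mul_nonneg (sub_nonneg.2 hcc)
        (add_nonneg (mul_self_nonneg (F z).re) (mul_self_nonneg (F z).im)),
      mul_nonneg (add_nonneg (mul_self_nonneg (1 - c.re)) (mul_self_nonneg c.im)) hre]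
  · have h : (1 - c + c * F z) / (1 - c + F z) - c = (1 - c) ^ 2 / (1 - c + F z) := by
      field_simp; ring
    rw [h, norm_div, norm_pow, div_le_iff₀ hpos]
    have h4 : 4 / δ ≤ ‖1 - c + F z‖ := by linarith [hK hzK]
    calc ‖1 - c‖ ^ 2 ≤ 2 ^ 2 := by gcongr
      _ = δ * (4 / δ) := by field_simp; norm_num
      _ ≤ _ := by gcongr
  · have h : (1 - c + c * F z) / (1 - c + F z) - 1 = -((1 - c) * F z / (1 - c + F z)) := by
      field_simp; ring
    rw [h, norm_neg, norm_div, norm_mul, div_le_iff₀ hpos]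
    calc ‖1 - c‖ * ‖F z‖ ≤ 2 * (δ * (1 - ‖c‖) / 2) := by gcongr; exact hfar hzU
      _ = δ * (1 - ‖c‖) := by ring
      _ ≤ _ := by gcongr; linarith

/-- An arclength-null subset of the circle is totally disconnected. -/
theorem isTotallyDisconnected_of_arclength_eq_zero {K : Set ℂ} (hKm : MeasurableSet K)
    (hKs : K ⊆ Metric.sphere (0:ℂ) 1) (hK0 : arclength K = 0) : IsTotallyDisconnected K := by
  have hnull : volume (circleMap 0 1 ⁻¹' K ∩ Set.Ioc 0 (2 * Real.pi)) = 0 := by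
    rwa [← arclength_apply hKm]
  have himage : ∀ L : ℂ →L[ℝ] ℝ, volume (L '' K) = 0 := by
    intro L
    have hdiff : Differentiable ℝ (fun θ => L (circleMap 0 1 θ)) :=
      L.differentiable.comp (differentiable_circleMap 0 1)
    refine measure_mono_null ?_
      (addHaar_image_eq_zero_of_differentiableOn_of_addHaar_eq_zero volume
        hdiff.differentiableOn hnull)
    rintro _ ⟨z, hz, rfl⟩
    have := hKs hz
    rw [← abs_one, ← image_circleMap_Ioc] at this
    obtain ⟨θ, hθ, rfl⟩ := this
    exact ⟨θ, ⟨hz, hθ⟩, rfl⟩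
  have heq : ∀ t ⊆ K, IsPreconnected t → ∀ x ∈ t, ∀ y ∈ t, ∀ L : ℂ →L[ℝ] ℝ, L y ≤ L x := by
    intro t htK ht x hx y hy L
    by_contra! h
    have hsub : Set.Icc (L x) (L y) ⊆ L '' K :=
      ((ht.image L L.continuous.continuousOn).Icc_subset
        (Set.mem_image_of_mem _ hx) (Set.mem_image_of_mem _ hy)).trans (Set.image_mono htK)
    have := measure_mono_null hsub (himage L)
    rw [Real.volume_Icc, ENNReal.ofReal_eq_zero] at this
    linarith
  intro t htK ht x hx y hy
  exact Complex.ext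
    (le_antisymm (heq t htK ht y hy x hx Complex.reCLM) (heq t htK ht x hx y hy Complex.reCLM))
    (le_antisymm (heq t htK ht y hy x hx Complex.imCLM) (heq t htK ht x hx y hy Complex.imCLM))

/-- Products of numbers in the closed unit disc differ by at most the sum of the differences of
the factors. -/
theorem norm_prod_sub_prod_le_sum_s11 {ι : Type*} (s : Finset ι) (a b : ι → ℂ)
    (ha : ∀ i ∈ s, ‖a i‖ ≤ 1) (hb : ∀ i ∈ s, ‖b i‖ ≤ 1) :
    ‖∏ i ∈ s, a i - ∏ i ∈ s, b i‖ ≤ ∑ i ∈ s, ‖a i - b i‖ := by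
  classical
  induction s using Finset.induction_on with
  | empty => simp
  | insert j s hj ih =>
    simp only [Finset.mem_insert, forall_eq_or_imp] at ha hb
    rw [Finset.prod_insert hj, Finset.prod_insert hj, Finset.sum_insert hj]
    have hprod : ‖∏ i ∈ s, b i‖ ≤ 1 := by
      rw [norm_prod]
      exact Finset.prod_le_one (fun _ _ => norm_nonneg _) hb.2
    calc _ = ‖a j * (∏ i ∈ s, a i - ∏ i ∈ s, b i) + (a j - b j) * ∏ i ∈ s, b i‖ := by
          congr 1; ring
      _ ≤ 1 * ‖∏ i ∈ s, a i - ∏ i ∈ s, b i‖ + ‖a j - b j‖ * 1 := by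
          refine (norm_add_le _ _).trans ?_
          rw [norm_mul, norm_mul]
          gcongr
          exact ha.1
      _ ≤ _ := by linarith [ih ha.2 hb.2]

/-- Approximation of a function of modulus less than one on a compact null subset of the circle
by functions in the unit ball of the disc algebra that are close to `1` away from it. -/
theorem exists_approx_near_one {K U : Set ℂ} (hKc : IsCompact K)
    (hKs : K ⊆ Metric.sphere (0:ℂ) 1) (hK0 : arclength K = 0) (hU : IsOpen U) (hKU : K ⊆ U)
    {φ : ℂ → ℂ} (hφc : ContinuousOn φ K) (hφ1 : ∀ z ∈ K, ‖φ z‖ < 1) {ε : ℝ} (hε : 0 < ε) :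
    ∃ h : ℂ → ℂ, ∀ z ∈ Metric.closedBall (0:ℂ) 1, DifferentiableAt ℂ h z ∧ ‖h z‖ ≤ 1 ∧
      (z ∈ K → ‖h z - φ z‖ < ε) ∧ (z ∉ U → ‖h z - 1‖ < ε) := by
  have := isCompact_iff_compactSpace.1 hKc
  have : TotallyDisconnectedSpace K := totallyDisconnectedSpace_subtype_iff.2
    (isTotallyDisconnected_of_arclength_eq_zero hKc.measurableSet hKs hK0)
  let Φ : C(K, Metric.ball (0:ℂ) 1) :=
    ⟨fun z => ⟨φ z, mem_ball_zero_iff.2 (hφ1 z z.2)⟩, hφc.domRestrict.subtype_mk fun z => mem_ball_zero_iff.2 (hφ1 z z.2)⟩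
  obtain ⟨n, k, c, hk, hkc⟩ := Φ.exists_finite_approximation_of_mem_nhds_diagonal
    (S := {q | dist q.1 q.2 < ε / 2})
    ((isOpen_lt (by fun_prop) continuous_const).mem_nhdsSet.2 (by
      rintro ⟨a, b⟩ (rfl : a = b)
      simpa using hε))
  have hc1 : ∀ i, ‖(c i : ℂ)‖ < 1 := fun i => mem_ball_zero_iff.1 (c i).2
  let P : Fin n → Set ℂ := fun i => Subtype.val '' (k ⁻¹' {i})
  have hPc : ∀ i, IsCompact (P i) := fun i =>
    (((isClosed_discrete {i}).preimage hk).isCompact).image continuous_subtype_val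
  have hPK : ∀ i, P i ⊆ K := by
    rintro i _ ⟨z, -, rfl⟩
    exact z.2
  let V : Fin n → Set ℂ := fun i => U ∩ (⋃ j ∈ {j | j ≠ i}, P j)ᶜ
  have hVo : ∀ i, IsOpen (V i) := fun i => hU.inter
    (((Set.toFinite {j | j ≠ i}).isCompact_biUnion fun j _ => hPc j).isClosed.isOpen_compl)
  have hPV : ∀ i, P i ⊆ V i := by
    rintro i _ ⟨z, hz, rfl⟩
    refine ⟨hKU z.2, fun h => ?_⟩
    obtain ⟨j, hj, z', hz', heq⟩ := Set.mem_iUnion₂.1 h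
    rw [Subtype.val_inj] at heq
    subst heq
    exact hj (hz'.symm.trans hz)
  have hδ : 0 < ε / (2 * (n + 1)) := by positivity
  choose p hp using fun i => exists_approx_const (hPc i) ((hPK i).trans hKs)
    (measure_mono_null (hPK i) hK0) (hVo i) (hPV i) (hc1 i) hδ
  have hsum : ∑ _i : Fin n, ε / (2 * (n + 1)) < ε / 2 := by
    rw [Finset.sum_const, Finset.card_univ, Fintype.card_fin, nsmul_eq_mul, mul_div_assoc',
      div_lt_div_iff₀ (by positivity) (by positivity)]
    nlinarith
  refine ⟨fun z => ∏ i, p i z, fun z hz => ⟨?_, ?_, fun hzK => ?_, fun hzU => ?_⟩⟩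
  · exact DifferentiableAt.fun_finsetProd fun i _ => (hp i z hz).1
  · rw [norm_prod]
    exact Finset.prod_le_one (fun _ _ => norm_nonneg _) fun i _ => (hp i z hz).2.1
  · have happrox : ‖(c (k ⟨z, hzK⟩) : ℂ) - φ z‖ < ε / 2 := by
      have := hkc ⟨z, hzK⟩
      rwa [Set.mem_ofPred_eq, dist_comm, Subtype.dist_eq, dist_eq_norm] at this
    have hprod := norm_prod_sub_prod_le_sum_s11 Finset.univ (fun i => p i z)
      (fun i => if i = k ⟨z, hzK⟩ then (c i : ℂ) else 1) (fun i _ => (hp i z hz).2.1)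
      (fun i _ => by split_ifs <;> simp [(hc1 _).le])
    rw [Finset.prod_ite_eq' Finset.univ, if_pos (Finset.mem_univ _)] at hprod
    have hle : ‖∏ i, p i z - c (k ⟨z, hzK⟩)‖ < ε / 2 := by
      refine (hprod.trans (Finset.sum_le_sum fun i _ => ?_)).trans_lt hsum
      split_ifs with hi
      · exact (hp i z hz).2.2.1 ⟨⟨z, hzK⟩, hi.symm, rfl⟩
      · refine (hp i z hz).2.2.2 fun hV => hV.2 (Set.mem_iUnion₂.2 ⟨k ⟨z, hzK⟩, Ne.symm hi, ?_⟩)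
        exact ⟨⟨z, hzK⟩, rfl, rfl⟩
    calc _ ≤ ‖∏ i, p i z - c (k ⟨z, hzK⟩)‖ + ‖(c (k ⟨z, hzK⟩) : ℂ) - φ z‖ :=
          norm_sub_le_norm_sub_add_norm_sub _ _ _
      _ < ε := by linarith
  · have hprod := norm_prod_sub_prod_le_sum_s11 Finset.univ (fun i => p i z) (fun _ => 1)
      (fun i _ => (hp i z hz).2.1) (fun i _ => by simp)
    rw [Finset.prod_const_one] at hprod
    have := (hprod.trans (Finset.sum_le_sum fun i _ =>
      (hp i z hz).2.2.2 fun hV => hzU hV.1)).trans_lt hsum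
    linarith

/-- A norm-one disc-algebra function approximating `φ` on `K` and close to `f` away from a
neighbourhood `U` of `K`, where `f` is in the closed unit ball of `A(𝔻)` and `|f| ≡ 1` on `K`. -/
theorem discAlgebra_approx (K : Set ℂ) (hKc : IsCompact K)
    (hKs : K ⊆ Metric.sphere (0:ℂ) 1) (hK0 : arclength K = 0)
    (φ : ℂ → ℂ) (hφc : ContinuousOn φ K) (hφ1 : ∀ z ∈ K, ‖φ z‖ ≤ 1)
    (U : Set ℂ) (hU : IsOpen U) (hKU : K ⊆ U)
    (f : ℂ → ℂ) (hfc : ContinuousOn f (Metric.closedBall (0:ℂ) 1))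
    (hfd : DifferentiableOn ℂ f (Metric.ball (0:ℂ) 1))
    (hfb : ∀ z ∈ Metric.closedBall (0:ℂ) 1, ‖f z‖ ≤ 1)
    (hf1 : ∀ z ∈ K, ‖f z‖ = 1)
    (ε : ℝ) (hε : 0 < ε) :
    ∃ g : ℂ → ℂ, ContinuousOn g (Metric.closedBall (0:ℂ) 1) ∧
      DifferentiableOn ℂ g (Metric.ball (0:ℂ) 1) ∧
      (∀ z ∈ Metric.closedBall (0:ℂ) 1, ‖g z‖ ≤ 1) ∧
      (∀ z ∈ K, ‖g z - φ z‖ < ε) ∧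
      (∀ z ∈ Metric.closedBall (0:ℂ) 1 \ U, ‖g z - f z‖ < ε) := by
  have hKb : K ⊆ Metric.closedBall (0:ℂ) 1 := hKs.trans Metric.sphere_subset_closedBall
  have hf0 : ∀ z ∈ K, f z ≠ 0 := fun z hz h => by simpa [h] using hf1 z hz
  let t : ℝ := 1 / (1 + ε / 2)
  have ht0 : 0 < t := by positivity
  have ht1 : t < 1 := by rw [div_lt_one (by positivity)]; linarith
  have htε : 1 - t < ε / 2 := by
    have : 1 - t = ε / 2 * t := by simp only [t]; field_simp; ring
    rw [this]
    nlinarith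
  have hψ1 : ∀ z ∈ K, ‖(t : ℂ) * (φ z / f z)‖ < 1 := by
    intro z hz
    rw [norm_mul, norm_div, hf1 z hz, div_one, Complex.norm_real, Real.norm_of_nonneg ht0.le]
    nlinarith [hφ1 z hz]
  obtain ⟨h, hh⟩ := exists_approx_near_one hKc hKs hK0 hU hKU
    (continuousOn_const.mul (hφc.div (hfc.mono hKb) hf0)) hψ1 (half_pos hε)
  refine ⟨fun z => f z * h z,
    hfc.mul fun z hz => (hh z hz).1.continuousAt.continuousWithinAt,
    hfd.mul fun z hz => (hh z (Metric.ball_subset_closedBall hz)).1.differentiableWithinAt,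
    fun z hz => ?_, fun z hz => ?_, fun z hz => ?_⟩
  · rw [norm_mul]
    exact mul_le_one₀ (hfb z hz) (norm_nonneg _) (hh z hz).2.1
  · have hdecomp : f z * h z - φ z
        = f z * (h z - (t : ℂ) * (φ z / f z)) + ((t - 1 : ℝ) : ℂ) * φ z := by
      have := hf0 z hz
      push_cast
      field_simp
      ring
    have hclose : ‖h z - (t : ℂ) * (φ z / f z)‖ < ε / 2 := (hh z (hKb hz)).2.2.1 hz
    have hscale : ‖((t - 1 : ℝ) : ℂ)‖ = 1 - t := by
      rw [Complex.norm_real, Real.norm_of_nonpos (by linarith), neg_sub]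
    rw [hdecomp]
    refine (norm_add_le _ _).trans_lt ?_
    rw [norm_mul, norm_mul, hf1 z hz, hscale]
    nlinarith [hφ1 z hz]
  · have hfar : ‖h z - 1‖ < ε / 2 := (hh z hz.1).2.2.2 hz.2
    have hdecomp : f z * h z - f z = f z * (h z - 1) := by ring
    rw [hdecomp, norm_mul]
    nlinarith [hfb z hz.1, norm_nonneg (h z - 1)]
end
end
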